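/- arXiv:1208.3777 — 3 statements merged into one kernel-verified Lean document; each statement's English description precedes it below -/
import Mathlib

section
/- There exists a real number M such that every real eigenvalue λ of the boundary value problem (P) satisfies λ ≥ M; that is, the real eigenvalues of (P) are bounded below. -/
open Set

/-- `u` solves the fourth order equation `a^4 u'''' + q u = λ u` on `S` and is
four times continuously differentiable there. -/
def SolvesODE (a : ℝ) (q : ℝ → ℝ) (lam : ℂ) (S : Set ℝ) (u : ℝ → ℂ) : Prop :=
  ContDiffOn ℝ 4 u S ∧
  ∀ x ∈ S, (a : ℂ) ^ 4 * iteratedDerivWithin 4 u S x + (q x : ℂ) * u x = lam * u x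

/-- `λ` is an eigenvalue of the discontinuous boundary value problem (P). -/
def IsEigenvalue (a1 a2 β1 β2 δ1 δ2 : ℝ) (q : ℝ → ℝ) (lam : ℂ) : Prop :=
  ∃ u1 u2 : ℝ → ℂ,
    SolvesODE a1 q lam (Icc (-1 : ℝ) 0) u1 ∧
    SolvesODE a2 q lam (Icc (0 : ℝ) 1) u2 ∧
    ¬ (EqOn u1 0 (Icc (-1 : ℝ) 0) ∧ EqOn u2 0 (Icc (0 : ℝ) 1)) ∧
    u1 (-1) = 0 ∧
    (β1 : ℂ) * iteratedDerivWithin 1 u1 (Icc (-1 : ℝ) 0) (-1)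
      + (β2 : ℂ) * iteratedDerivWithin 2 u1 (Icc (-1 : ℝ) 0) (-1) = 0 ∧
    u2 0 = u1 0 ∧
    iteratedDerivWithin 1 u2 (Icc (0 : ℝ) 1) 0 = iteratedDerivWithin 1 u1 (Icc (-1 : ℝ) 0) 0 ∧
    iteratedDerivWithin 2 u2 (Icc (0 : ℝ) 1) 0 - iteratedDerivWithin 2 u1 (Icc (-1 : ℝ) 0) 0
      + lam * (δ1 : ℂ) * iteratedDerivWithin 1 u1 (Icc (-1 : ℝ) 0) 0 = 0 ∧
    iteratedDerivWithin 3 u2 (Icc (0 : ℝ) 1) 0 - iteratedDerivWithin 3 u1 (Icc (-1 : ℝ) 0) 0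
      + lam * (δ2 : ℂ) * u1 0 = 0 ∧
    lam * u2 1 + iteratedDerivWithin 3 u2 (Icc (0 : ℝ) 1) 1 = 0 ∧
    lam * iteratedDerivWithin 1 u2 (Icc (0 : ℝ) 1) 1
      + iteratedDerivWithin 2 u2 (Icc (0 : ℝ) 1) 1 = 0

/-- `g₁` and `g₂` are the first and second derivatives of `g` on `[a, b]`, and `g₂` is
continuous there. -/
structure IsC2Chain (a b : ℝ) (g g₁ g₂ : ℝ → ℝ) : Prop where
  deriv_zero : ∀ x ∈ Icc a b, HasDerivWithinAt g (g₁ x) (Icc a b) x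
  deriv_one : ∀ x ∈ Icc a b, HasDerivWithinAt g₁ (g₂ x) (Icc a b) x
  cont : ContinuousOn g₂ (Icc a b)

namespace IsC2Chain

variable {a b : ℝ} {f f₁ f₂ g g₁ g₂ : ℝ → ℝ}

lemma cont_zero (hg : IsC2Chain a b g g₁ g₂) : ContinuousOn g (Icc a b) :=
  fun x hx => (hg.deriv_zero x hx).continuousWithinAt

lemma cont_one (hg : IsC2Chain a b g g₁ g₂) : ContinuousOn g₁ (Icc a b) :=
  fun x hx => (hg.deriv_one x hx).continuousWithinAt

lemma mono (hg : IsC2Chain a b g g₁ g₂) {α β : ℝ} (h : Icc α β ⊆ Icc a b) :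
    IsC2Chain α β g g₁ g₂ :=
  ⟨fun x hx => (hg.deriv_zero x (h hx)).mono h, fun x hx => (hg.deriv_one x (h hx)).mono h,
    hg.cont.mono h⟩

/-- Green's formula for the second derivative. -/
lemma green (hab : a ≤ b) (hf : IsC2Chain a b f f₁ f₂) (hg : IsC2Chain a b g g₁ g₂) :
    ∫ x in a..b, (f x * g₂ x - f₂ x * g x) =
      (f b * g₁ b - f₁ b * g b) - (f a * g₁ a - f₁ a * g a) := by
  have hF : ContinuousOn (fun x => f x * g₁ x - f₁ x * g x) (Icc a b) :=
    (hf.cont_zero.mul hg.cont_one).sub (hf.cont_one.mul hg.cont_zero)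
  have hF' : ContinuousOn (fun x => f x * g₂ x - f₂ x * g x) (Icc a b) :=
    (hf.cont_zero.mul hg.cont).sub (hf.cont.mul hg.cont_zero)
  refine intervalIntegral.integral_eq_sub_of_hasDerivAt_of_le hab hF (fun x hx => ?_)
    (hF'.intervalIntegrable_of_Icc hab)
  have hx' := Ioo_subset_Icc_self hx
  have hn := Icc_mem_nhds hx.1 hx.2
  have := (((hf.deriv_zero x hx').hasDerivAt hn).mul ((hg.deriv_one x hx').hasDerivAt hn)).sub
    (((hf.deriv_one x hx').hasDerivAt hn).mul ((hg.deriv_zero x hx').hasDerivAt hn))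
  exact this.congr_deriv (by ring)

/-- Testing against a kernel `f` bounds the boundary terms in Green's formula. -/
lemma sq_boundary_le (hab : a < b) (hf : IsC2Chain a b f f₁ f₂) (hg : IsC2Chain a b g g₁ g₂)
    {P Q : ℝ} (hP : ∀ x ∈ Icc a b, f x ^ 2 ≤ P) (hQ : ∀ x ∈ Icc a b, f₂ x ^ 2 ≤ Q) :
    ((f b * g₁ b - f₁ b * g b) - (f a * g₁ a - f₁ a * g a)) ^ 2 ≤
      2 * (b - a) * (P * (∫ x in a..b, g₂ x ^ 2) + Q * ∫ x in a..b, g x ^ 2) := by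
  have hG := green hab.le hf hg
  set W := (f b * g₁ b - f₁ b * g b) - (f a * g₁ a - f₁ a * g a) with hW
  have hh : 0 < b - a := sub_pos.2 hab
  have hF' : ContinuousOn (fun x => f x * g₂ x - f₂ x * g x) (Icc a b) :=
    (hf.cont_zero.mul hg.cont).sub (hf.cont.mul hg.cont_zero)
  have hi2 : IntervalIntegrable (fun x => g₂ x ^ 2) MeasureTheory.volume a b :=
    (hg.cont.pow 2).intervalIntegrable_of_Icc hab.le
  have hi0 : IntervalIntegrable (fun x => g x ^ 2) MeasureTheory.volume a b :=
    (hg.cont_zero.pow 2).intervalIntegrable_of_Icc hab.le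
  have hle : ∫ x in a..b, W * (f x * g₂ x - f₂ x * g x) ≤
      ∫ x in a..b, (W ^ 2 / (2 * (b - a)) +
        (b - a) * (P * g₂ x ^ 2 + Q * g x ^ 2)) := by
    refine intervalIntegral.integral_mono_on hab.le
      ((hF'.intervalIntegrable_of_Icc hab.le).const_mul W)
      (intervalIntegrable_const.add (((hi2.const_mul P).add (hi0.const_mul Q)).const_mul _))
      fun x hx => ?_
    have key : ∀ y : ℝ, W * y ≤ W ^ 2 / (4 * (b - a)) + (b - a) * y ^ 2 := fun y => by
      have : W ^ 2 / (4 * (b - a)) + (b - a) * y ^ 2 - W * y =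
          (W - 2 * (b - a) * y) ^ 2 / (4 * (b - a)) := by field_simp; ring
      have h2 : 0 ≤ (W - 2 * (b - a) * y) ^ 2 / (4 * (b - a)) := by positivity
      linarith
    have k1 := key (f x * g₂ x)
    have k2 := key (-(f₂ x * g x))
    have b1 : (f x * g₂ x) ^ 2 ≤ P * g₂ x ^ 2 := by
      rw [mul_pow]; exact mul_le_mul_of_nonneg_right (hP x hx) (sq_nonneg _)
    have b2 : (-(f₂ x * g x)) ^ 2 ≤ Q * g x ^ 2 := by
      rw [neg_sq, mul_pow]; exact mul_le_mul_of_nonneg_right (hQ x hx) (sq_nonneg _)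
    have b3 := mul_le_mul_of_nonneg_left (add_le_add b1 b2) hh.le
    have e : W ^ 2 / (2 * (b - a)) = W ^ 2 / (4 * (b - a)) + W ^ 2 / (4 * (b - a)) := by
      field_simp; ring
    rw [e]
    linarith
  rw [intervalIntegral.integral_const_mul, hG, intervalIntegral.integral_add
    intervalIntegrable_const (((hi2.const_mul P).add (hi0.const_mul Q)).const_mul _),
    intervalIntegral.integral_const, intervalIntegral.integral_const_mul,
    intervalIntegral.integral_add (hi2.const_mul P) (hi0.const_mul Q),
    intervalIntegral.integral_const_mul, intervalIntegral.integral_const_mul, smul_eq_mul] at hle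
  have e : (b - a) * (W ^ 2 / (2 * (b - a))) = W ^ 2 / 2 := by field_simp
  rw [e] at hle
  linarith

/-- The cubic `(1 - t)² (c + e t)` in the affine variable `t = m x + n`, with its derivatives. -/
lemma cubic (a b m n c e : ℝ) :
    IsC2Chain a b (fun x => (1 - (m * x + n)) ^ 2 * (c + e * (m * x + n)))
      (fun x => m * (e * (1 - (m * x + n)) ^ 2 - 2 * (1 - (m * x + n)) * (c + e * (m * x + n))))
      (fun x => m ^ 2 * (2 * (c + e * (m * x + n)) - 4 * e * (1 - (m * x + n)))) := by
  have ht : ∀ x, HasDerivAt (fun x => m * x + n) m x := fun x => by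
    simpa using ((hasDerivAt_id x).const_mul m).add_const n
  have h1 : ∀ x, HasDerivAt (fun x => 1 - (m * x + n)) (-m) x := fun x => (ht x).const_sub 1
  have h2 : ∀ x, HasDerivAt (fun x => c + e * (m * x + n)) (e * m) x := fun x =>
    ((ht x).const_mul e).const_add c
  refine ⟨fun x _ => HasDerivAt.hasDerivWithinAt ?_, fun x _ => HasDerivAt.hasDerivWithinAt ?_, ?_⟩
  · exact (((h1 x).pow 2).mul (h2 x)).congr_deriv (by simp only [Pi.pow_apply]; ring)
  · exact (((((h1 x).pow 2).const_mul e).sub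
      (((h1 x).const_mul 2).mul (h2 x))).const_mul m).congr_deriv (by ring)
  · fun_prop

lemma sq_boundary_cubic_le (hab : a < b) (hg : IsC2Chain a b g g₁ g₂) (m n c e : ℝ)
    (hm : m ^ 2 = ((b - a) ^ 2)⁻¹) (ht : ∀ x ∈ Icc a b, 0 ≤ m * x + n ∧ m * x + n ≤ 1)
    (hc : 0 ≤ c) (hc' : c ≤ 1) (he : 0 ≤ e) (he' : e ≤ 2) {φ φ₁ : ℝ → ℝ}
    (hφ : ∀ x, φ x = (1 - (m * x + n)) ^ 2 * (c + e * (m * x + n)))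
    (hφ₁ : ∀ x, φ₁ x =
      m * (e * (1 - (m * x + n)) ^ 2 - 2 * (1 - (m * x + n)) * (c + e * (m * x + n)))) :
    ((φ b * g₁ b - φ₁ b * g b) - (φ a * g₁ a - φ₁ a * g a)) ^ 2 ≤
      2 * (b - a) * (9 * (∫ x in a..b, g₂ x ^ 2) +
        (64 * (((b - a) ^ 2)⁻¹) ^ 2) * ∫ x in a..b, g x ^ 2) := by
  obtain rfl : φ = _ := funext hφ
  obtain rfl : φ₁ = _ := funext hφ₁
  refine sq_boundary_le hab (cubic a b m n c e) hg (fun x hx => ?_) (fun x hx => ?_)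
  · obtain ⟨h0, h1⟩ := ht x hx
    generalize m * x + n = t at h0 h1
    have e1 : (1 - t) ^ 2 ≤ 1 := by nlinarith
    have e2 : 0 ≤ e * t := by positivity
    have e3 : e * t ≤ 2 := by nlinarith
    have e4 : (1 - t) ^ 2 * (c + e * t) ≤ 1 * 3 :=
      mul_le_mul e1 (by linarith) (by linarith) zero_le_one
    have e5 : 0 ≤ (1 - t) ^ 2 * (c + e * t) := by positivity
    nlinarith
  · obtain ⟨h0, h1⟩ := ht x hx
    generalize m * x + n = t at h0 h1
    rw [mul_pow, hm, mul_comm]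
    refine mul_le_mul_of_nonneg_right ?_ (sq_nonneg _)
    have e2 : 0 ≤ e * t := by positivity
    have e3 : e * t ≤ 2 := by nlinarith
    have e4 : 0 ≤ e * (1 - t) := mul_nonneg he (by linarith)
    have e5 : e * (1 - t) ≤ 2 := by nlinarith
    have : |2 * (c + e * t) - 4 * e * (1 - t)| ≤ 8 := abs_le.2 ⟨by linarith, by linarith⟩
    calc _ = |2 * (c + e * t) - 4 * e * (1 - t)| ^ 2 := (sq_abs _).symm
      _ ≤ 8 ^ 2 := by gcongr
      _ = 64 := by norm_num

lemma sq_left_le (hab : a < b) (hab1 : b - a ≤ 1) (hg : IsC2Chain a b g g₁ g₂) :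
    max (g a ^ 2) (g₁ a ^ 2) ≤ 2 * (b - a) * (9 * (∫ x in a..b, g₂ x ^ 2) +
        (64 * (((b - a) ^ 2)⁻¹) ^ 2) * ∫ x in a..b, g x ^ 2) := by
  have hh : 0 < b - a := sub_pos.2 hab
  have ea : (b - a)⁻¹ * a + -((b - a)⁻¹ * a) = 0 := by ring
  have eb : (b - a)⁻¹ * b + -((b - a)⁻¹ * a) = 1 := by field_simp; ring
  have ht : ∀ x ∈ Icc a b, 0 ≤ (b - a)⁻¹ * x + -((b - a)⁻¹ * a) ∧
      (b - a)⁻¹ * x + -((b - a)⁻¹ * a) ≤ 1 := fun x hx => by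
    have hi : 0 ≤ (b - a)⁻¹ := by positivity
    have := mul_le_mul_of_nonneg_left hx.1 hi
    have := mul_le_mul_of_nonneg_left hx.2 hi
    constructor <;> linarith
  have h1 := sq_boundary_cubic_le hab hg (b - a)⁻¹ (-((b - a)⁻¹ * a)) 0 1 (inv_pow _ _) ht
    le_rfl zero_le_one zero_le_one one_le_two (fun _ => rfl) (fun _ => rfl)
  have h2 := sq_boundary_cubic_le hab hg (b - a)⁻¹ (-((b - a)⁻¹ * a)) 1 2 (inv_pow _ _) ht
    zero_le_one le_rfl zero_le_two le_rfl (fun _ => rfl) (fun _ => rfl)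
  rw [ea, eb] at h1 h2
  refine max_le (le_trans ?_ h1) (le_trans (le_of_eq ?_) h2)
  · have : 1 ≤ (b - a)⁻¹ := (one_le_inv₀ hh).2 hab1
    have h3 : 1 ≤ (b - a)⁻¹ ^ 2 := one_le_pow₀ this
    nlinarith [mul_le_mul_of_nonneg_right h3 (sq_nonneg (g a))]
  · ring

lemma sq_right_le (hab : a < b) (hab1 : b - a ≤ 1) (hg : IsC2Chain a b g g₁ g₂) :
    max (g b ^ 2) (g₁ b ^ 2) ≤ 2 * (b - a) * (9 * (∫ x in a..b, g₂ x ^ 2) +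
        (64 * (((b - a) ^ 2)⁻¹) ^ 2) * ∫ x in a..b, g x ^ 2) := by
  have hh : 0 < b - a := sub_pos.2 hab
  have eb : -(b - a)⁻¹ * b + (b - a)⁻¹ * b = 0 := by ring
  have ea : -(b - a)⁻¹ * a + (b - a)⁻¹ * b = 1 := by field_simp; ring
  have ht : ∀ x ∈ Icc a b, 0 ≤ -(b - a)⁻¹ * x + (b - a)⁻¹ * b ∧
      -(b - a)⁻¹ * x + (b - a)⁻¹ * b ≤ 1 := fun x hx => by
    have hi : 0 ≤ (b - a)⁻¹ := by positivity
    have := mul_le_mul_of_nonneg_left hx.1 hi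
    have := mul_le_mul_of_nonneg_left hx.2 hi
    constructor <;> linarith
  have hm : (-(b - a)⁻¹) ^ 2 = ((b - a) ^ 2)⁻¹ := by rw [neg_sq, inv_pow]
  have h1 := sq_boundary_cubic_le hab hg (-(b - a)⁻¹) ((b - a)⁻¹ * b) 0 1 hm ht
    le_rfl zero_le_one zero_le_one one_le_two (fun _ => rfl) (fun _ => rfl)
  have h2 := sq_boundary_cubic_le hab hg (-(b - a)⁻¹) ((b - a)⁻¹ * b) 1 2 hm ht
    zero_le_one le_rfl zero_le_two le_rfl (fun _ => rfl) (fun _ => rfl)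
  rw [ea, eb] at h1 h2
  refine max_le (le_trans ?_ h1) (le_trans (le_of_eq ?_) h2)
  · have : 1 ≤ (b - a)⁻¹ := (one_le_inv₀ hh).2 hab1
    have h3 : 1 ≤ (b - a)⁻¹ ^ 2 := one_le_pow₀ this
    nlinarith [mul_le_mul_of_nonneg_right h3 (sq_nonneg (g b))]
  · ring

lemma integral_sq_mono {α β : ℝ} (hf : ContinuousOn f (Icc a b)) (haα : a ≤ α) (hαβ : α ≤ β)
    (hβb : β ≤ b) : ∫ x in α..β, f x ^ 2 ≤ ∫ x in a..b, f x ^ 2 :=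
  intervalIntegral.integral_mono_interval haα hαβ hβb
    (Filter.Eventually.of_forall fun x => sq_nonneg (f x))
    ((hf.pow 2).intervalIntegrable_of_Icc (haα.trans (hαβ.trans hβb)))

/-- Interpolation: boundary values of `g` and `g'` are controlled by a small multiple of
`∫ g''²` and a large multiple of `∫ g²`. -/
lemma exists_interpolation (hab : a < b) {ε : ℝ} (hε : 0 < ε) :
    ∃ C : ℝ, ∀ g g₁ g₂ : ℝ → ℝ, IsC2Chain a b g g₁ g₂ →
      max (max (g a ^ 2) (g₁ a ^ 2)) (max (g b ^ 2) (g₁ b ^ 2)) ≤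
        ε * (∫ x in a..b, g₂ x ^ 2) + C * ∫ x in a..b, g x ^ 2 := by
  obtain ⟨h, h0, h1, h2, h3⟩ : ∃ h : ℝ, 0 < h ∧ h ≤ 1 ∧ h ≤ b - a ∧ 18 * h ≤ ε := by
    refine ⟨min 1 (min (b - a) (ε / 18)), ?_, min_le_left _ _,
      (min_le_right _ _).trans (min_le_left _ _), ?_⟩
    · have := sub_pos.2 hab
      positivity
    · have : min 1 (min (b - a) (ε / 18)) ≤ ε / 18 := (min_le_right _ _).trans (min_le_right _ _)
      linarith
  refine ⟨128 * h * ((h ^ 2)⁻¹) ^ 2, fun g g₁ g₂ hg => ?_⟩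
  have step : ∀ A B A' B' : ℝ, 0 ≤ A → A ≤ A' → B ≤ B' →
      2 * h * (9 * A + (64 * ((h ^ 2)⁻¹) ^ 2) * B) ≤ ε * A' + 128 * h * ((h ^ 2)⁻¹) ^ 2 * B' := by
    intro A B A' B' hA hAA hBB
    have e1 : 18 * h * A ≤ ε * A' := mul_le_mul h3 hAA hA hε.le
    have e2 : 128 * h * ((h ^ 2)⁻¹) ^ 2 * B ≤ 128 * h * ((h ^ 2)⁻¹) ^ 2 * B' :=
      mul_le_mul_of_nonneg_left hBB (by positivity)
    linarith
  refine max_le ?_ ?_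
  · have hs : Icc a (a + h) ⊆ Icc a b := Icc_subset_Icc le_rfl (by linarith)
    have := sq_left_le (by linarith) (by linarith) (hg.mono hs)
    rw [add_sub_cancel_left] at this
    exact this.trans (step _ _ _ _ (intervalIntegral.integral_nonneg (by linarith)
      fun x _ => sq_nonneg _) (integral_sq_mono hg.cont le_rfl (by linarith) (by linarith))
      (integral_sq_mono hg.cont_zero le_rfl (by linarith) (by linarith)))
  · have hs : Icc (b - h) b ⊆ Icc a b := Icc_subset_Icc (by linarith) le_rfl
    have := sq_right_le (by linarith) (by linarith) (hg.mono hs)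
    rw [sub_sub_cancel] at this
    exact this.trans (step _ _ _ _ (intervalIntegral.integral_nonneg (by linarith)
      fun x _ => sq_nonneg _) (integral_sq_mono hg.cont (by linarith) (by linarith) le_rfl)
      (integral_sq_mono hg.cont_zero (by linarith) (by linarith) le_rfl))

end IsC2Chain

/-- A real equation `a⁴ u₄ + q u₀ = -μ u₀` for a chain of four derivatives on `[s, t]`. -/
structure IsRealSolution (a : ℝ) (q : ℝ → ℝ) (μ s t : ℝ) (u₀ u₁ u₂ u₃ u₄ : ℝ → ℝ) : Prop where
  low : IsC2Chain s t u₀ u₁ u₂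
  high : IsC2Chain s t u₂ u₃ u₄
  eqn : ∀ x ∈ Icc s t, a ^ 4 * u₄ x + q x * u₀ x = -μ * u₀ x

lemma SolvesODE.isRealSolution {a s t : ℝ} {q : ℝ → ℝ} {lam : ℂ} {u : ℝ → ℂ} (hst : s < t)
    (hu : SolvesODE a q lam (Icc s t) u) (hlam : lam.im = 0) (L : ℂ →L[ℝ] ℝ) :
    IsRealSolution a q (-lam.re) s t (fun x => L (u x))
      (fun x => L (iteratedDerivWithin 1 u (Icc s t) x))
      (fun x => L (iteratedDerivWithin 2 u (Icc s t) x))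
      (fun x => L (iteratedDerivWithin 3 u (Icc s t) x))
      (fun x => L (iteratedDerivWithin 4 u (Icc s t) x)) := by
  obtain ⟨hc, he⟩ := hu
  have hU : UniqueDiffOn ℝ (Icc s t) := uniqueDiffOn_Icc hst
  have hd : ∀ k : ℕ, k < 4 → ∀ x ∈ Icc s t,
      HasDerivWithinAt (fun x => L (iteratedDerivWithin k u (Icc s t) x))
        (L (iteratedDerivWithin (k + 1) u (Icc s t) x)) (Icc s t) x := fun k hk x hx => by
    have h1 := (hc.differentiableOn_iteratedDerivWithin (m := k) (by exact_mod_cast hk) hU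
      x hx).hasDerivWithinAt
    rw [← iteratedDerivWithin_succ] at h1
    exact L.hasFDerivAt.comp_hasDerivWithinAt x h1
  have hcont : ∀ k : ℕ, k ≤ 4 →
      ContinuousOn (fun x => L (iteratedDerivWithin k u (Icc s t) x)) (Icc s t) := fun k hk =>
    L.continuous.comp_continuousOn
      (hc.continuousOn_iteratedDerivWithin (by exact_mod_cast hk) hU)
  refine ⟨⟨fun x hx => ?_, hd 1 (by norm_num), hcont 2 (by norm_num)⟩,
    ⟨hd 2 (by norm_num), hd 3 (by norm_num), hcont 4 (by norm_num)⟩, fun x hx => ?_⟩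
  · simpa only [iteratedDerivWithin_zero] using hd 0 (by norm_num) x hx
  · have hl : lam = (lam.re : ℂ) := Complex.ext rfl (by simp [hlam])
    have h1 := he x hx
    rw [hl, ← Complex.ofReal_pow, ← Complex.real_smul, ← Complex.real_smul,
      ← Complex.real_smul] at h1
    have h2 := congrArg L h1
    simpa only [map_add, map_smul, smul_eq_mul, neg_neg] using h2

namespace IsRealSolution

variable {a μ s t : ℝ} {q u₀ u₁ u₂ u₃ u₄ : ℝ → ℝ}

lemma energy_le (h : IsRealSolution a q μ s t u₀ u₁ u₂ u₃ u₄) (hst : s ≤ t) (ha : 0 < a)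
    (hq : ∀ x ∈ Icc s t, 2 * |q x| ≤ μ) :
    (∫ x in s..t, u₂ x ^ 2) + μ / (2 * a ^ 4) * (∫ x in s..t, u₀ x ^ 2) ≤
      (u₀ s * u₃ s - u₁ s * u₂ s) - (u₀ t * u₃ t - u₁ t * u₂ t) := by
  have hG := h.low.green hst h.high
  have hi0 : IntervalIntegrable (fun x => u₀ x ^ 2) MeasureTheory.volume s t :=
    (h.low.cont_zero.pow 2).intervalIntegrable_of_Icc hst
  have hi2 : IntervalIntegrable (fun x => u₂ x ^ 2) MeasureTheory.volume s t :=
    (h.low.cont.pow 2).intervalIntegrable_of_Icc hst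
  have hle : ∫ x in s..t, (u₀ x * u₄ x - u₂ x * u₂ x) ≤
      ∫ x in s..t, -(u₂ x ^ 2 + μ / (2 * a ^ 4) * u₀ x ^ 2) := by
    refine intervalIntegral.integral_mono_on hst
      (((h.low.cont_zero.mul h.high.cont).sub
        (h.low.cont.mul h.low.cont)).intervalIntegrable_of_Icc hst)
      (hi2.add (hi0.const_mul _)).neg fun x hx => ?_
    have hu : u₄ x = -((q x + μ) / a ^ 4) * u₀ x := by
      have := h.eqn x hx
      field_simp
      linarith
    have hqx := hq x hx
    have hq' := neg_abs_le (q x)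
    have : μ / (2 * a ^ 4) ≤ (q x + μ) / a ^ 4 := by
      rw [← div_div]
      gcongr
      linarith
    rw [hu]
    nlinarith [mul_le_mul_of_nonneg_right this (sq_nonneg (u₀ x))]
  rw [hG, intervalIntegral.integral_neg, intervalIntegral.integral_add hi2 (hi0.const_mul _),
    intervalIntegral.integral_const_mul] at hle
  linarith

lemma integral_sq_le (h : IsRealSolution a q μ s t u₀ u₁ u₂ u₃ u₄) (hst : s ≤ t) (ha : 0 < a)
    (hq : ∀ x ∈ Icc s t, 2 * |q x| ≤ μ) :
    (∫ x in s..t, u₄ x ^ 2) ≤ 4 / (a ^ 4) ^ 2 * μ ^ 2 * ∫ x in s..t, u₀ x ^ 2 := by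
  rw [← intervalIntegral.integral_const_mul]
  refine intervalIntegral.integral_mono_on hst
    ((h.high.cont.pow 2).intervalIntegrable_of_Icc hst)
    (((h.low.cont_zero.pow 2).intervalIntegrable_of_Icc hst).const_mul _) fun x hx => ?_
  have hu : u₄ x = -((q x + μ) / a ^ 4) * u₀ x := by
    have := h.eqn x hx
    field_simp
    linarith
  have hqx := hq x hx
  have hq1 := abs_nonneg (q x)
  have : (q x + μ) ^ 2 ≤ 4 * μ ^ 2 := by
    have h1 : |q x + μ| ≤ 2 * μ :=
      abs_le.2 ⟨by linarith [neg_abs_le (q x)], by linarith [le_abs_self (q x)]⟩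
    calc _ = |q x + μ| ^ 2 := (sq_abs _).symm
      _ ≤ (2 * μ) ^ 2 := by gcongr
      _ = _ := by ring
  rw [hu, mul_pow, neg_sq, div_pow]
  refine mul_le_mul_of_nonneg_right ?_ (sq_nonneg _)
  rw [div_mul_eq_mul_div]
  gcongr

end IsRealSolution

lemma eqOn_zero_of_integral_sq_nonpos {s t : ℝ} (hst : s < t) {f : ℝ → ℝ}
    (hf : ContinuousOn f (Icc s t)) (h : ∫ x in s..t, f x ^ 2 ≤ 0) :
    ∀ x ∈ Icc s t, f x = 0 := by
  intro x hx
  by_contra hne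
  exact absurd (intervalIntegral.integral_pos hst (hf.pow 2) (fun y _ => sq_nonneg (f y))
    ⟨x, hx, sq_pos_iff.2 hne⟩) h.not_gt

/-- A jump `p - r = μ δ y` makes `(p - r) y` small compared with `p² + r²` for large `μ`. -/
lemma abs_jump_mul_le {μ δ y p r : ℝ} (hμ : 0 < μ) (h : p - r = μ * δ * y) :
    |(p - r) * y| ≤ 2 * |δ|⁻¹ * (p ^ 2 + r ^ 2) / μ := by
  rcases eq_or_ne δ 0 with rfl | hδ
  · simp [h]
  · have hδ' : 0 < |δ| := abs_pos.2 hδ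
    have e : |(p - r) * y| = |δ|⁻¹ * (p - r) ^ 2 / μ := by
      rw [h, show μ * δ * y * y = δ * (μ * y ^ 2) by ring, abs_mul,
        abs_of_nonneg (by positivity : 0 ≤ μ * y ^ 2)]
      field_simp
      rw [sq_abs, mul_comm]
    rw [e]
    have : (p - r) ^ 2 ≤ 2 * (p ^ 2 + r ^ 2) := by nlinarith [sq_nonneg (p + r)]
    calc |δ|⁻¹ * (p - r) ^ 2 / μ ≤ |δ|⁻¹ * (2 * (p ^ 2 + r ^ 2)) / μ := by gcongr
      _ = _ := by ring

lemma abs_mul_le_of_linear_eq_zero {β₁ β₂ y z : ℝ} (hβ : |β₁| + |β₂| ≠ 0)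
    (h : β₁ * y + β₂ * z = 0) : |y * z| ≤ |β₁ / β₂| * y ^ 2 := by
  rcases eq_or_ne β₂ 0 with rfl | hβ₂
  · have hβ₁ : β₁ ≠ 0 := by simpa using hβ
    have : y = 0 := by simpa [hβ₁] using h
    simp [this]
  · have hz : z = -(β₁ / β₂) * y := by
      field_simp
      linarith
    rw [hz, show y * (-(β₁ / β₂) * y) = -(β₁ / β₂) * y ^ 2 by ring, abs_mul, abs_neg,
      abs_of_nonneg (sq_nonneg y)]

/-- For large `μ` the energy estimate absorbs all boundary terms. -/
lemma integrals_nonpos_of_energy {k K D ε C μ U U₂ U₄ V V₂ V₄ : ℝ} (hμ : 0 < μ)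
    (hD : 0 ≤ D) (hε : 0 ≤ ε) (hU : 0 ≤ U) (hU₂ : 0 ≤ U₂) (hV : 0 ≤ V)
    (hV₂ : 0 ≤ V₂) (hk : 0 < k)
    (hU₄ : U₄ ≤ K * μ ^ 2 * U) (hV₄ : V₄ ≤ K * μ ^ 2 * V)
    (h1 : D * ε * K ≤ k / 4) (h2 : D * ε ≤ 1 / 4) (h3 : D * C ≤ μ / 4) (h4 : D * C ≤ k * μ / 4)
    (hE : U₂ + V₂ + k * μ * (U + V) ≤
      D * ((ε * U₄ + C * U₂) + (ε * V₄ + C * V₂)) / μ + D * (ε * U₂ + C * U)) :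
    U ≤ 0 ∧ V ≤ 0 := by
  have e1 : D * ((ε * U₄ + C * U₂) + (ε * V₄ + C * V₂)) ≤
      μ * (k / 4 * μ * (U + V) + 1 / 4 * (U₂ + V₂)) := by
    have a1 : D * ε * (U₄ + V₄) ≤ D * ε * (K * μ ^ 2 * (U + V)) :=
      mul_le_mul_of_nonneg_left (by linarith) (by positivity)
    have a2 : D * ε * K * (μ ^ 2 * (U + V)) ≤ k / 4 * (μ ^ 2 * (U + V)) :=
      mul_le_mul_of_nonneg_right h1 (by positivity)
    have a3 : D * C * (U₂ + V₂) ≤ μ / 4 * (U₂ + V₂) :=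
      mul_le_mul_of_nonneg_right h3 (by positivity)
    linarith
  have e2 := (div_le_iff₀' hμ).2 e1
  have e3 : D * ε * U₂ ≤ 1 / 4 * U₂ := mul_le_mul_of_nonneg_right h2 hU₂
  have e4 : D * C * U ≤ k * μ / 4 * U := mul_le_mul_of_nonneg_right h4 hU
  have hkμ : 0 < k * μ := mul_pos hk hμ
  have pU := mul_nonneg hkμ.le hU
  have pV := mul_nonneg hkμ.le hV
  constructor
  · have : k * μ * U ≤ 0 := by linarith
    exact nonpos_of_mul_nonpos_right this hkμ
  · have : k * μ * V ≤ 0 := by linarith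
    exact nonpos_of_mul_nonpos_right this hkμ

/-- For `λ = -μ` with `μ` large, the real boundary value problem has only the zero solution. -/
lemma exists_forall_real_solution_eq_zero {a1 a2 β1 β2 : ℝ} (δ1 δ2 : ℝ) (ha1 : 0 < a1)
    (ha2 : 0 < a2) (hβ : |β1| + |β2| ≠ 0) {q : ℝ → ℝ}
    (hq1 : ContinuousOn q (Icc (-1 : ℝ) 0)) (hq2 : ContinuousOn q (Icc (0 : ℝ) 1)) :
    ∃ μ₀ : ℝ, ∀ μ, μ₀ ≤ μ → ∀ u₀ u₁ u₂ u₃ u₄ v₀ v₁ v₂ v₃ v₄ : ℝ → ℝ,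
      IsRealSolution a1 q μ (-1) 0 u₀ u₁ u₂ u₃ u₄ →
      IsRealSolution a2 q μ 0 1 v₀ v₁ v₂ v₃ v₄ →
      u₀ (-1) = 0 → β1 * u₁ (-1) + β2 * u₂ (-1) = 0 → v₀ 0 = u₀ 0 → v₁ 0 = u₁ 0 →
      v₂ 0 - u₂ 0 = μ * δ1 * u₁ 0 → v₃ 0 - u₃ 0 = μ * δ2 * u₀ 0 →
      v₃ 1 = μ * v₀ 1 → v₂ 1 = μ * v₁ 1 →
      (∀ x ∈ Icc (-1 : ℝ) 0, u₀ x = 0) ∧ ∀ x ∈ Icc (0 : ℝ) 1, v₀ x = 0 := by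
  obtain ⟨Q1, hQ1⟩ := isCompact_Icc.exists_bound_of_continuousOn hq1
  obtain ⟨Q2, hQ2⟩ := isCompact_Icc.exists_bound_of_continuousOn hq2
  obtain ⟨K, hK0, hK1, hK2⟩ : ∃ K : ℝ, 0 < K ∧ 4 / (a1 ^ 4) ^ 2 ≤ K ∧ 4 / (a2 ^ 4) ^ 2 ≤ K :=
    ⟨max (4 / (a1 ^ 4) ^ 2) (4 / (a2 ^ 4) ^ 2), by positivity, le_max_left _ _, le_max_right _ _⟩
  obtain ⟨k, hk0, hk1, hk2⟩ : ∃ k : ℝ, 0 < k ∧ k ≤ 1 / (2 * a1 ^ 4) ∧ k ≤ 1 / (2 * a2 ^ 4) :=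
    ⟨min (1 / (2 * a1 ^ 4)) (1 / (2 * a2 ^ 4)), by positivity, min_le_left _ _, min_le_right _ _⟩
  obtain ⟨D, hD0, hD1, hD2⟩ : ∃ D : ℝ, 0 < D ∧ 2 * |δ1|⁻¹ + 2 * |δ2|⁻¹ + 1 ≤ D ∧
      |β1 / β2| ≤ D :=
    ⟨2 * |δ1|⁻¹ + 2 * |δ2|⁻¹ + 1 + |β1 / β2|, by positivity,
      le_add_of_nonneg_right (abs_nonneg _), le_add_of_nonneg_left (by positivity)⟩
  obtain ⟨ε, hε0, hε1, hε2⟩ : ∃ ε : ℝ, 0 < ε ∧ D * ε * K ≤ k / 4 ∧ D * ε ≤ 1 / 4 := by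
    refine ⟨min (k / (4 * D * K)) (1 / (4 * D)), by positivity, ?_, ?_⟩
    · calc D * min (k / (4 * D * K)) (1 / (4 * D)) * K ≤ D * (k / (4 * D * K)) * K := by
            gcongr; exact min_le_left _ _
        _ = k / 4 := by field_simp
    · calc D * min (k / (4 * D * K)) (1 / (4 * D)) ≤ D * (1 / (4 * D)) := by
            gcongr; exact min_le_right _ _
        _ = 1 / 4 := by field_simp
  obtain ⟨C1, hC1⟩ := IsC2Chain.exists_interpolation (by norm_num : (-1 : ℝ) < 0) hε0
  obtain ⟨C2, hC2⟩ := IsC2Chain.exists_interpolation (zero_lt_one (α := ℝ)) hε0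
  obtain ⟨C, hC1C, hC2C⟩ : ∃ C : ℝ, C1 ≤ C ∧ C2 ≤ C :=
    ⟨max C1 C2, le_max_left _ _, le_max_right _ _⟩
  refine ⟨max 1 (max (max (2 * Q1) (2 * Q2)) (max (4 * (D * C)) (4 * (D * C) / k))),
    fun μ hμ u₀ u₁ u₂ u₃ u₄ v₀ v₁ v₂ v₃ v₄ hu hv b1 b2 b3 b4 b5 b6 b7 b8 => ?_⟩
  simp only [max_le_iff] at hμ
  obtain ⟨hμ1, ⟨hμQ1, hμQ2⟩, hμD, hμk⟩ := hμ
  have hμ0 : 0 < μ := zero_lt_one.trans_le hμ1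
  have hqu : ∀ x ∈ Icc (-1 : ℝ) 0, 2 * |q x| ≤ μ := fun x hx => by
    have := hQ1 x hx
    rw [Real.norm_eq_abs] at this
    linarith
  have hqv : ∀ x ∈ Icc (0 : ℝ) 1, 2 * |q x| ≤ μ := fun x hx => by
    have := hQ2 x hx
    rw [Real.norm_eq_abs] at this
    linarith
  have Eu := hu.energy_le (by norm_num) ha1 hqu
  have Ev := hv.energy_le zero_le_one ha2 hqv
  have U4 := hu.integral_sq_le (by norm_num) ha1 hqu
  have V4 := hv.integral_sq_le zero_le_one ha2 hqv
  have Iu := hC1 _ _ _ hu.low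
  have Iu' := hC1 _ _ _ hu.high
  have Iv' := hC2 _ _ _ hv.high
  have hnonneg : ∀ (s t : ℝ) (f : ℝ → ℝ), s ≤ t → 0 ≤ ∫ x in s..t, f x ^ 2 := fun s t f h =>
    intervalIntegral.integral_nonneg h fun x _ => sq_nonneg _
  have nU := hnonneg (-1) 0 u₀ (by norm_num)
  have nU2 := hnonneg (-1) 0 u₂ (by norm_num)
  have nV := hnonneg 0 1 v₀ zero_le_one
  have nV2 := hnonneg 0 1 v₂ zero_le_one
  suffices h : (∫ x in (-1 : ℝ)..0, u₀ x ^ 2) ≤ 0 ∧ (∫ x in (0 : ℝ)..1, v₀ x ^ 2) ≤ 0 from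
    ⟨eqOn_zero_of_integral_sq_nonpos (by norm_num) hu.low.cont_zero h.1,
      eqOn_zero_of_integral_sq_nonpos zero_lt_one hv.low.cont_zero h.2⟩
  generalize (∫ x in (-1 : ℝ)..0, u₀ x ^ 2) = U at *
  generalize (∫ x in (-1 : ℝ)..0, u₂ x ^ 2) = U₂ at *
  generalize (∫ x in (-1 : ℝ)..0, u₄ x ^ 2) = U₄ at *
  generalize (∫ x in (0 : ℝ)..1, v₀ x ^ 2) = V at *
  generalize (∫ x in (0 : ℝ)..1, v₂ x ^ 2) = V₂ at *
  generalize (∫ x in (0 : ℝ)..1, v₄ x ^ 2) = V₄ at *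
  simp only [max_le_iff] at Iu Iu' Iv'
  have c1 : C1 * U ≤ C * U := by gcongr
  have c2 : C1 * U₂ ≤ C * U₂ := by gcongr
  have c3 : C2 * V₂ ≤ C * V₂ := by gcongr
  have J2 := abs_jump_mul_le hμ0 b5
  have J3 := abs_jump_mul_le hμ0 b6
  have J0 := abs_mul_le_of_linear_eq_zero hβ b2
  have J1 : μ * v₁ 1 ^ 2 = v₂ 1 ^ 2 / μ := by
    rw [b8]
    field_simp
  set X := ε * U₄ + C * U₂ with hX
  set Y := ε * V₄ + C * V₂ with hY
  have Y0 : 0 ≤ Y := by linarith [sq_nonneg (v₂ 1)]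
  have X0 : 0 ≤ X := by linarith [sq_nonneg (u₂ 0)]
  have B3 : 2 * |δ2|⁻¹ * (v₃ 0 ^ 2 + u₃ 0 ^ 2) / μ ≤ 2 * |δ2|⁻¹ * (X + Y) / μ := by
    gcongr ?_ * ?_ / _
    linarith
  have B2 : 2 * |δ1|⁻¹ * (v₂ 0 ^ 2 + u₂ 0 ^ 2) / μ ≤ 2 * |δ1|⁻¹ * (X + Y) / μ := by
    gcongr ?_ * ?_ / _
    linarith
  have B1 : v₂ 1 ^ 2 / μ ≤ (X + Y) / μ := by
    gcongr ?_ / _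
    linarith
  have B0 : |β1 / β2| * u₁ (-1) ^ 2 ≤ D * (ε * U₂ + C * U) := by
    gcongr
    linarith
  have BD : (2 * |δ1|⁻¹ + 2 * |δ2|⁻¹ + 1) * (X + Y) / μ ≤ D * (X + Y) / μ := by gcongr
  have BE : (2 * |δ1|⁻¹ + 2 * |δ2|⁻¹ + 1) * (X + Y) / μ =
      2 * |δ1|⁻¹ * (X + Y) / μ + 2 * |δ2|⁻¹ * (X + Y) / μ + (X + Y) / μ := by ring
  have kU : k * μ * U ≤ μ / (2 * a1 ^ 4) * U := by
    rw [mul_comm k, ← mul_one_div μ]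
    gcongr
  have kV : k * μ * V ≤ μ / (2 * a2 ^ 4) * V := by
    rw [mul_comm k, ← mul_one_div μ]
    gcongr
  refine integrals_nonpos_of_energy (k := k) (K := K) (D := D) (ε := ε) (C := C) (U₂ := U₂)
    (U₄ := U₄) (V₂ := V₂) (V₄ := V₄) hμ0 hD0.le hε0.le nU nU2 nV nV2 hk0
    (U4.trans (by gcongr)) (V4.trans (by gcongr)) hε1 hε2 (by linarith) ?_ ?_
  · rw [div_le_iff₀ hk0] at hμk
    linarith
  · rw [b3, b4, b7, b8] at Ev
    rw [b1] at Eu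
    have j2 := neg_abs_le ((v₂ 0 - u₂ 0) * u₁ 0)
    have j3 := le_abs_self ((v₃ 0 - u₃ 0) * u₀ 0)
    have j0 := neg_abs_le (u₁ (-1) * u₂ (-1))
    have j1 : 0 ≤ μ * v₀ 1 ^ 2 := by positivity
    linarith

/-- Corollary 4.5: the real eigenvalues of the problem (P) are bounded below. -/
theorem real_eigenvalues_bounded_below
    (a1 a2 β1 β2 δ1 δ2 : ℝ) (ha1 : 0 < a1) (ha2 : 0 < a2)
    (hβ : |β1| + |β2| ≠ 0) (hδ : |δ1| + |δ2| ≠ 0) (q : ℝ → ℝ)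
    (hq1 : ContinuousOn q (Icc (-1 : ℝ) 0)) (hq2 : ContinuousOn q (Icc (0 : ℝ) 1)) :
    ∃ M : ℝ, ∀ lam : ℂ, IsEigenvalue a1 a2 β1 β2 δ1 δ2 q lam → lam.im = 0 →
      M ≤ lam.re := by
  obtain ⟨μ₀, hμ₀⟩ := exists_forall_real_solution_eq_zero δ1 δ2 ha1 ha2 hβ hq1 hq2
  refine ⟨-μ₀, fun lam hlam him => ?_⟩
  by_contra! hlt
  obtain ⟨u, v, hu, hv, hne, b1, b2, b3, b4, b5, b6, b7, b8⟩ := hlam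
  have hl : lam = (lam.re : ℂ) := Complex.ext rfl (by simp [him])
  rw [hl] at b5 b6 b7 b8
  have key : ∀ L : ℂ →L[ℝ] ℝ,
      (∀ x ∈ Icc (-1 : ℝ) 0, L (u x) = 0) ∧ ∀ x ∈ Icc (0 : ℝ) 1, L (v x) = 0 := fun L => by
    have hL : ∀ (r : ℝ) (z : ℂ), L (r * z) = r * L z := fun r z => by
      rw [← Complex.real_smul, map_smul, smul_eq_mul]
    refine hμ₀ (-lam.re) (by linarith) _ _ _ _ _ _ _ _ _ _
      (hu.isRealSolution (by norm_num) him L) (hv.isRealSolution zero_lt_one him L)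
      (by rw [b1, map_zero]) ?_ (by rw [b3]) (by rw [b4]) ?_ ?_ ?_ ?_
    · simpa only [map_add, map_zero, hL] using congrArg L b2
    · have := congrArg L b5
      simp only [mul_assoc, map_add, map_sub, map_zero, hL] at this
      linarith
    · have := congrArg L b6
      simp only [mul_assoc, map_add, map_sub, map_zero, hL] at this
      linarith
    · have := congrArg L b7
      simp only [map_add, map_zero, hL] at this
      linarith
    · have := congrArg L b8
      simp only [map_add, map_zero, hL] at this
      linarith
  have hre := key Complex.reCLM
  have him' := key Complex.imCLM
  exact hne ⟨fun x hx => Complex.ext (hre.1 x hx) (him'.1 x hx),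
    fun x hx => Complex.ext (hre.2 x hx) (him'.2 x hx)⟩
end

section
/- There exists a real number R > 0 such that every eigenvalue λ of the boundary value problem (P) with λ ∉ ℝ satisfies |λ| ≤ R; that is, the non-real eigenvalues of (P) form a bounded subset of ℂ. -/
open Set

namespace SolvesODE

variable {a lo hi : ℝ} {q : ℝ → ℝ} {lam mu : ℂ} {u v : ℝ → ℂ}

theorem hasDerivWithinAt (h : SolvesODE a q lam (Icc lo hi) u) (hlt : lo < hi) {k : ℕ}
    (hk : k < 4) {x : ℝ} (hx : x ∈ Icc lo hi) :
    HasDerivWithinAt (iteratedDerivWithin k u (Icc lo hi))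
      (iteratedDerivWithin (k + 1) u (Icc lo hi) x) (Icc lo hi) x := by
  rw [iteratedDerivWithin_succ]
  exact (h.1.differentiableOn_iteratedDerivWithin (by exact_mod_cast hk)
    (uniqueDiffOn_Icc hlt) x hx).hasDerivWithinAt

theorem iteratedDerivWithin_four (h : SolvesODE a q lam (Icc lo hi) u) (ha : 0 < a) {x : ℝ}
    (hx : x ∈ Icc lo hi) :
    iteratedDerivWithin 4 u (Icc lo hi) x = (lam - q x) / (a : ℂ) ^ 4 * u x := by
  have ha' : (a : ℂ) ≠ 0 := by exact_mod_cast ha.ne'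
  have := h.2 x hx
  field_simp
  linear_combination this

theorem continuousOn_mul_star (hu : SolvesODE a q lam (Icc lo hi) u)
    (hv : SolvesODE a q mu (Icc lo hi) v) :
    ContinuousOn (fun x => u x * star (v x)) (Icc lo hi) :=
  hu.1.continuousOn.mul hv.1.continuousOn.star

end SolvesODE

/-- The boundary form in the Lagrange identity for the fourth derivative operator. -/
noncomputable def lagrangeForm (S : Set ℝ) (u v : ℝ → ℂ) (x : ℝ) : ℂ :=
  iteratedDerivWithin 3 u S x * star (iteratedDerivWithin 0 v S x)
    - iteratedDerivWithin 2 u S x * star (iteratedDerivWithin 1 v S x)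
    + iteratedDerivWithin 1 u S x * star (iteratedDerivWithin 2 v S x)
    - iteratedDerivWithin 0 u S x * star (iteratedDerivWithin 3 v S x)

theorem lagrange_identity {a lo hi : ℝ} {q : ℝ → ℝ} {lam mu : ℂ} {u v : ℝ → ℂ}
    (ha : 0 < a) (hlt : lo < hi) (hu : SolvesODE a q lam (Icc lo hi) u)
    (hv : SolvesODE a q mu (Icc lo hi) v) :
    lagrangeForm (Icc lo hi) u v hi - lagrangeForm (Icc lo hi) u v lo
      = (lam - star mu) * (((a ^ 4)⁻¹ : ℝ) * ∫ x in lo..hi, u x * star (v x)) := by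
  have hderiv : ∀ x ∈ Icc lo hi, HasDerivWithinAt (lagrangeForm (Icc lo hi) u v)
      ((lam - star mu) * ((a ^ 4)⁻¹ : ℝ) * (u x * star (v x))) (Icc lo hi) x := by
    intro x hx
    have du := fun {k : ℕ} (hk : k < 4) => hu.hasDerivWithinAt hlt hk hx
    have dv := fun {k : ℕ} (hk : k < 4) => (hv.hasDerivWithinAt hlt hk hx).star
    have d := ((((du (k := 3) (by norm_num)).mul (dv (k := 0) (by norm_num))).sub
      ((du (k := 2) (by norm_num)).mul (dv (k := 1) (by norm_num)))).add
      ((du (k := 1) (by norm_num)).mul (dv (k := 2) (by norm_num)))).sub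
      ((du (k := 0) (by norm_num)).mul (dv (k := 3) (by norm_num)))
    refine d.congr_deriv ?_
    simp only [Nat.reduceAdd, zero_add, hu.iteratedDerivWithin_four ha hx,
      hv.iteratedDerivWithin_four ha hx, iteratedDerivWithin_zero]
    simp only [star_mul', star_div₀, star_sub, star_pow, Complex.star_def, Complex.conj_ofReal]
    push_cast
    ring
  have hcont : ContinuousOn
      (fun x => (lam - star mu) * ((a ^ 4)⁻¹ : ℝ) * (u x * star (v x))) (Icc lo hi) :=
    continuousOn_const.mul (hu.continuousOn_mul_star hv)
  rw [← intervalIntegral.integral_eq_sub_of_hasDerivAt_of_le hlt.le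
    (fun x hx => (hderiv x hx).continuousWithinAt)
    (fun x hx => (hderiv x (Ioo_subset_Icc_self hx)).hasDerivAt (Icc_mem_nhds hx.1 hx.2))
    (hcont.intervalIntegrable_of_Icc hlt.le), intervalIntegral.integral_const_mul, mul_assoc]

section LinearCombinations

variable {ι : Type*} [Fintype ι] {a lo hi : ℝ} {q : ℝ → ℝ} {lam : ι → ℂ} {u : ι → ℝ → ℂ}

theorem sum_mul_iteratedDerivWithin_eq_zero (hlt : lo < hi)
    (hu : ∀ i, SolvesODE a q (lam i) (Icc lo hi) (u i)) (c : ι → ℂ)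
    (h0 : ∀ x ∈ Icc lo hi, ∑ i, c i * u i x = 0) {k : ℕ} (hk : k ≤ 4) :
    ∀ x ∈ Icc lo hi, ∑ i, c i * iteratedDerivWithin k (u i) (Icc lo hi) x = 0 := by
  induction k with
  | zero => simpa using h0
  | succ k ih =>
    intro x hx
    have d := HasDerivWithinAt.fun_sum (u := Finset.univ) fun i _ =>
      ((hu i).hasDerivWithinAt hlt hk hx).const_mul (c i)
    have d0 := (hasDerivWithinAt_const x (Icc lo hi) (0 : ℂ)).congr
      (ih (Nat.le_of_succ_le hk)) (ih (Nat.le_of_succ_le hk) x hx)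
    exact (uniqueDiffOn_Icc hlt x hx).eq_deriv _ d d0

theorem sum_mul_eigenvalue_eq_zero (ha : 0 < a) (hlt : lo < hi)
    (hu : ∀ i, SolvesODE a q (lam i) (Icc lo hi) (u i)) (c : ι → ℂ)
    (h0 : ∀ x ∈ Icc lo hi, ∑ i, c i * u i x = 0) :
    ∀ x ∈ Icc lo hi, ∑ i, c i * lam i * u i x = 0 := by
  intro x hx
  have ha' : (a : ℂ) ≠ 0 := by exact_mod_cast ha.ne'
  have h4 := sum_mul_iteratedDerivWithin_eq_zero hlt hu c h0 le_rfl x hx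
  calc ∑ i, c i * lam i * u i x
      = (a : ℂ) ^ 4 * ∑ i, c i * iteratedDerivWithin 4 (u i) (Icc lo hi) x
          + q x * ∑ i, c i * u i x := by
        rw [Finset.mul_sum, Finset.mul_sum, ← Finset.sum_add_distrib]
        refine Finset.sum_congr rfl fun i _ => ?_
        linear_combination -(c i) * (hu i).2 x hx
    _ = 0 := by rw [h4, h0 x hx]; simp

/-- Solutions for distinct spectral parameters satisfy no nontrivial linear relation. -/
theorem mul_eq_zero_of_sum_mul_eq_zero {n : ℕ} {lam : Fin n → ℂ} {u : Fin n → ℝ → ℂ}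
    (ha : 0 < a) (hlt : lo < hi) (hlam : Function.Injective lam)
    (hu : ∀ i, SolvesODE a q (lam i) (Icc lo hi) (u i)) (c : Fin n → ℂ)
    (h0 : ∀ x ∈ Icc lo hi, ∑ i, c i * u i x = 0) (i : Fin n) :
    ∀ x ∈ Icc lo hi, c i * u i x = 0 := by
  have hpow : ∀ k : ℕ, ∀ x ∈ Icc lo hi, ∑ i, c i * lam i ^ k * u i x = 0 := by
    intro k
    induction k with
    | zero => simpa using h0
    | succ k ih =>
      simpa only [pow_succ, mul_assoc] using
        sum_mul_eigenvalue_eq_zero ha hlt hu (fun i => c i * lam i ^ k) ih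
  intro x hx
  refine congrFun (Matrix.eq_zero_of_forall_pow_sum_mul_pow_eq_zero
    (v := fun i => c i * u i x) hlam fun k => ?_) i
  rw [← hpow k x hx]
  exact Finset.sum_congr rfl fun i _ => by ring

theorem integral_sum_mul_star_sum (hle : lo ≤ hi)
    (hu : ∀ i, SolvesODE a q (lam i) (Icc lo hi) (u i)) (c : ι → ℂ) :
    ∫ x in lo..hi, (∑ i, c i * u i x) * star (∑ i, c i * u i x)
      = ∑ i, ∑ j, c i * star (c j) * ∫ x in lo..hi, u i x * star (u j x) := by
  have hint : ∀ i j, IntervalIntegrable (fun x => c i * star (c j) * (u i x * star (u j x)))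
      MeasureTheory.volume lo hi := fun i j =>
    (continuousOn_const.mul
      ((hu i).continuousOn_mul_star (hu j))).intervalIntegrable_of_Icc hle
  have hexp : ∀ x, (∑ i, c i * u i x) * star (∑ i, c i * u i x)
      = ∑ i, ∑ j, c i * star (c j) * (u i x * star (u j x)) := by
    intro x
    rw [star_sum, Finset.sum_mul_sum]
    refine Finset.sum_congr rfl fun i _ => Finset.sum_congr rfl fun j _ => ?_
    rw [star_mul']
    ring
  simp_rw [hexp]
  have hsum : ∀ i, IntervalIntegrable (fun x => ∑ j, c i * star (c j) * (u i x * star (u j x)))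
      MeasureTheory.volume lo hi := fun i => by
    simpa only [Finset.sum_fn] using IntervalIntegrable.sum Finset.univ fun j _ => hint i j
  rw [intervalIntegral.integral_finsetSum fun i _ => hsum i]
  refine Finset.sum_congr rfl fun i _ => ?_
  rw [intervalIntegral.integral_finsetSum fun j _ => hint i j]
  exact Finset.sum_congr rfl fun j _ => intervalIntegral.integral_const_mul _ _

end LinearCombinations

theorem integral_mul_star_self (f : ℝ → ℂ) (lo hi : ℝ) :
    ∫ x in lo..hi, f x * star (f x) = ((∫ x in lo..hi, ‖f x‖ ^ 2 : ℝ) : ℂ) := by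
  rw [← intervalIntegral.integral_ofReal]
  refine intervalIntegral.integral_congr fun x _ => ?_
  simp [Complex.mul_conj']

theorem eqOn_zero_of_integral_norm_sq_eq_zero {f : ℝ → ℂ} {lo hi : ℝ} (hlt : lo < hi)
    (hf : ContinuousOn f (Icc lo hi)) (h : ∫ x in lo..hi, ‖f x‖ ^ 2 = 0) :
    ∀ x ∈ Icc lo hi, f x = 0 := by
  intro x hx
  by_contra hne
  have := intervalIntegral.integral_pos hlt (hf.norm.pow 2) (fun _ _ => sq_nonneg _)
    ⟨x, hx, pow_pos (norm_pos_iff.2 hne) 2⟩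
  exact this.ne' h

/-- The indefinite inner product for which the problem (P) is symmetric. -/
noncomputable def indefiniteForm (a1 a2 δ1 δ2 : ℝ) (u1 u2 v1 v2 : ℝ → ℂ) : ℂ :=
  ((a1 ^ 4)⁻¹ : ℝ) * (∫ x in (-1 : ℝ)..0, u1 x * star (v1 x))
    + ((a2 ^ 4)⁻¹ : ℝ) * (∫ x in (0 : ℝ)..1, u2 x * star (v2 x))
    + u2 1 * star (v2 1)
    - iteratedDerivWithin 1 u2 (Icc 0 1) 1 * star (iteratedDerivWithin 1 v2 (Icc 0 1) 1)
    - δ2 * (u1 0 * star (v1 0))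
    + δ1 * (iteratedDerivWithin 1 u1 (Icc (-1) 0) 0
        * star (iteratedDerivWithin 1 v1 (Icc (-1) 0) 0))

/-- `(u1, u2)` satisfies the equations, boundary and transmission conditions of (P). -/
def SolvesProblem (a1 a2 β1 β2 δ1 δ2 : ℝ) (q : ℝ → ℝ) (lam : ℂ) (u1 u2 : ℝ → ℂ) : Prop :=
  SolvesODE a1 q lam (Icc (-1 : ℝ) 0) u1 ∧
  SolvesODE a2 q lam (Icc (0 : ℝ) 1) u2 ∧
  u1 (-1) = 0 ∧
  (β1 : ℂ) * iteratedDerivWithin 1 u1 (Icc (-1 : ℝ) 0) (-1)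
    + (β2 : ℂ) * iteratedDerivWithin 2 u1 (Icc (-1 : ℝ) 0) (-1) = 0 ∧
  u2 0 = u1 0 ∧
  iteratedDerivWithin 1 u2 (Icc (0 : ℝ) 1) 0 = iteratedDerivWithin 1 u1 (Icc (-1 : ℝ) 0) 0 ∧
  iteratedDerivWithin 2 u2 (Icc (0 : ℝ) 1) 0 - iteratedDerivWithin 2 u1 (Icc (-1 : ℝ) 0) 0
    + lam * (δ1 : ℂ) * iteratedDerivWithin 1 u1 (Icc (-1 : ℝ) 0) 0 = 0 ∧
  iteratedDerivWithin 3 u2 (Icc (0 : ℝ) 1) 0 - iteratedDerivWithin 3 u1 (Icc (-1 : ℝ) 0) 0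
    + lam * (δ2 : ℂ) * u1 0 = 0 ∧
  lam * u2 1 + iteratedDerivWithin 3 u2 (Icc (0 : ℝ) 1) 1 = 0 ∧
  lam * iteratedDerivWithin 1 u2 (Icc (0 : ℝ) 1) 1
    + iteratedDerivWithin 2 u2 (Icc (0 : ℝ) 1) 1 = 0

theorem lagrangeForm_eq_zero_of_separated {β1 β2 : ℝ} (hβ : |β1| + |β2| ≠ 0) {S : Set ℝ}
    {u v : ℝ → ℂ} {x : ℝ} (hu0 : u x = 0) (hv0 : v x = 0)
    (hu : (β1 : ℂ) * iteratedDerivWithin 1 u S x + (β2 : ℂ) * iteratedDerivWithin 2 u S x = 0)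
    (hv : (β1 : ℂ) * iteratedDerivWithin 1 v S x + (β2 : ℂ) * iteratedDerivWithin 2 v S x = 0) :
    lagrangeForm S u v x = 0 := by
  have hv' : (β1 : ℂ) * star (iteratedDerivWithin 1 v S x)
      + (β2 : ℂ) * star (iteratedDerivWithin 2 v S x) = 0 := by
    simpa using congrArg star hv
  simp only [lagrangeForm, iteratedDerivWithin_zero, hu0, hv0, star_zero, mul_zero, zero_mul,
    zero_sub, sub_zero]
  by_cases h1 : β1 = 0
  · have h2 : (β2 : ℂ) ≠ 0 := by
      rintro h
      simp_all
    apply mul_left_cancel₀ h2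
    linear_combination (-star (iteratedDerivWithin 1 v S x)) * hu
      + iteratedDerivWithin 1 u S x * hv'
  · have h1' : (β1 : ℂ) ≠ 0 := by exact_mod_cast h1
    apply mul_left_cancel₀ h1'
    linear_combination (star (iteratedDerivWithin 2 v S x)) * hu
      - iteratedDerivWithin 2 u S x * hv'

theorem SolvesProblem.indefiniteForm_eq_zero {a1 a2 β1 β2 δ1 δ2 : ℝ} {q : ℝ → ℝ} {lam mu : ℂ}
    {u1 u2 v1 v2 : ℝ → ℂ} (ha1 : 0 < a1) (ha2 : 0 < a2) (hβ : |β1| + |β2| ≠ 0)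
    (hu : SolvesProblem a1 a2 β1 β2 δ1 δ2 q lam u1 u2)
    (hv : SolvesProblem a1 a2 β1 β2 δ1 δ2 q mu v1 v2) (hne : lam ≠ star mu) :
    indefiniteForm a1 a2 δ1 δ2 u1 u2 v1 v2 = 0 := by
  obtain ⟨ou1, ou2, u0, ub, uc0, uc1, uc2, uc3, ue3, ue2⟩ := hu
  obtain ⟨ov1, ov2, v0, vb, vc0, vc1, vc2, vc3, ve3, ve2⟩ := hv
  have L1 := lagrange_identity ha1 (by norm_num) ou1 ov1
  have L2 := lagrange_identity ha2 (by norm_num) ou2 ov2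
  rw [lagrangeForm_eq_zero_of_separated hβ u0 v0 ub vb] at L1
  apply mul_left_cancel₀ (sub_ne_zero.2 hne)
  have wc0 := congrArg star vc0
  have wc1 := congrArg star vc1
  have wc2 := congrArg star vc2
  have wc3 := congrArg star vc3
  have we3 := congrArg star ve3
  have we2 := congrArg star ve2
  simp only [star_add, star_sub, star_mul', star_zero] at wc2 wc3 we3 we2
  have hδ1 : star (δ1 : ℂ) = δ1 := Complex.conj_ofReal _
  have hδ2 : star (δ2 : ℂ) = δ2 := Complex.conj_ofReal _
  rw [hδ1] at wc2
  rw [hδ2] at wc3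
  simp only [lagrangeForm, iteratedDerivWithin_zero] at L1 L2
  rw [uc0, wc0, uc1, wc1, eq_neg_of_add_eq_zero_right ue3, eq_neg_of_add_eq_zero_right ue2,
    eq_neg_of_add_eq_zero_right we3, eq_neg_of_add_eq_zero_right we2] at L2
  rw [indefiniteForm]
  linear_combination -L1 - L2 - star (v1 0) * uc3
    + star (iteratedDerivWithin 1 v1 (Icc (-1 : ℝ) 0) 0) * uc2
    - iteratedDerivWithin 1 u1 (Icc (-1 : ℝ) 0) 0 * wc2 + u1 0 * wc3

theorem exists_ne_zero_sum_mul_eq_zero {m n : ℕ} (hmn : m < n) (f : Fin m → Fin n → ℂ) :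
    ∃ c : Fin n → ℂ, c ≠ 0 ∧ ∀ k, ∑ i, c i * f k i = 0 := by
  have hker := LinearMap.ker_ne_bot_of_finrank_lt (f := Matrix.mulVecLin (Matrix.of f))
    (by simpa using hmn)
  obtain ⟨c, hc, hc0⟩ := Submodule.exists_mem_ne_zero_of_ne_bot hker
  refine ⟨c, hc0, fun k => ?_⟩
  have := congrFun (LinearMap.mem_ker.1 hc) k
  simpa [Matrix.mulVec, dotProduct, mul_comm] using this

/-- The indefinite form has at most three negative squares, so an isotropic family of
eigenfunctions for distinct eigenvalues has at most three members. -/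
theorem not_forall_indefiniteForm_eq_zero {a1 a2 δ1 δ2 : ℝ} {q : ℝ → ℝ} (ha1 : 0 < a1)
    (ha2 : 0 < a2) {lam : Fin 4 → ℂ} (hlam : Function.Injective lam) {u1 u2 : Fin 4 → ℝ → ℂ}
    (h1 : ∀ i, SolvesODE a1 q (lam i) (Icc (-1 : ℝ) 0) (u1 i))
    (h2 : ∀ i, SolvesODE a2 q (lam i) (Icc (0 : ℝ) 1) (u2 i))
    (hne : ∀ i, ¬ (EqOn (u1 i) 0 (Icc (-1 : ℝ) 0) ∧ EqOn (u2 i) 0 (Icc (0 : ℝ) 1))) :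
    ¬ ∀ i j, indefiniteForm a1 a2 δ1 δ2 (u1 i) (u2 i) (u1 j) (u2 j) = 0 := by
  intro hiso
  obtain ⟨c, hc0, hc⟩ := exists_ne_zero_sum_mul_eq_zero (m := 3) (n := 4) (by norm_num)
    ![fun i => iteratedDerivWithin 1 (u2 i) (Icc (0 : ℝ) 1) 1, fun i => u1 i 0,
      fun i => iteratedDerivWithin 1 (u1 i) (Icc (-1 : ℝ) 0) 0]
  have hk0 : ∑ i, c i * iteratedDerivWithin 1 (u2 i) (Icc (0 : ℝ) 1) 1 = 0 := hc 0
  have hk1 : ∑ i, c i * u1 i 0 = 0 := hc 1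
  have hk2 : ∑ i, c i * iteratedDerivWithin 1 (u1 i) (Icc (-1 : ℝ) 0) 0 = 0 := hc 2
  have hexp : ∀ f : Fin 4 → ℂ, ∑ i, ∑ j, c i * star (c j) * (f i * star (f j))
      = (∑ i, c i * f i) * star (∑ i, c i * f i) := by
    intro f
    rw [star_sum, Finset.sum_mul_sum]
    refine Finset.sum_congr rfl fun i _ => Finset.sum_congr rfl fun j _ => ?_
    rw [star_mul']
    ring
  have hsum : ∑ i, ∑ j, c i * star (c j)
      * indefiniteForm a1 a2 δ1 δ2 (u1 i) (u2 i) (u1 j) (u2 j) = 0 := by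
    simp [hiso]
  have hsplit : ∑ i, ∑ j, c i * star (c j)
      * indefiniteForm a1 a2 δ1 δ2 (u1 i) (u2 i) (u1 j) (u2 j)
      = ((a1 ^ 4)⁻¹ : ℝ) * (∑ i, ∑ j, c i * star (c j)
          * ∫ x in (-1 : ℝ)..0, u1 i x * star (u1 j x))
        + ((a2 ^ 4)⁻¹ : ℝ) * (∑ i, ∑ j, c i * star (c j)
          * ∫ x in (0 : ℝ)..1, u2 i x * star (u2 j x))
        + (∑ i, ∑ j, c i * star (c j) * (u2 i 1 * star (u2 j 1)))
        - (∑ i, ∑ j, c i * star (c j) * (iteratedDerivWithin 1 (u2 i) (Icc 0 1) 1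
            * star (iteratedDerivWithin 1 (u2 j) (Icc 0 1) 1)))
        - δ2 * (∑ i, ∑ j, c i * star (c j) * (u1 i 0 * star (u1 j 0)))
        + δ1 * (∑ i, ∑ j, c i * star (c j) * (iteratedDerivWithin 1 (u1 i) (Icc (-1) 0) 0
            * star (iteratedDerivWithin 1 (u1 j) (Icc (-1) 0) 0))) := by
    simp only [Finset.mul_sum, ← Finset.sum_add_distrib, ← Finset.sum_sub_distrib]
    refine Finset.sum_congr rfl fun i _ => Finset.sum_congr rfl fun j _ => ?_
    rw [indefiniteForm]
    ring
  rw [hsum, ← integral_sum_mul_star_sum (by norm_num) h1 c,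
    ← integral_sum_mul_star_sum (by norm_num) h2 c, hexp fun i => u2 i 1,
    hexp fun i => iteratedDerivWithin 1 (u2 i) (Icc 0 1) 1, hexp fun i => u1 i 0,
    hexp fun i => iteratedDerivWithin 1 (u1 i) (Icc (-1) 0) 0, hk0, hk1, hk2,
    integral_mul_star_self, integral_mul_star_self, Complex.star_def, Complex.mul_conj'] at hsplit
  simp only [zero_mul, mul_zero, sub_zero, add_zero] at hsplit
  have hreal : 0 = (a1 ^ 4)⁻¹ * (∫ x in (-1 : ℝ)..0, ‖∑ i, c i * u1 i x‖ ^ 2)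
      + (a2 ^ 4)⁻¹ * (∫ x in (0 : ℝ)..1, ‖∑ i, c i * u2 i x‖ ^ 2)
      + ‖∑ i, c i * u2 i 1‖ ^ 2 := by
    exact_mod_cast hsplit
  have hp1 : 0 ≤ ∫ x in (-1 : ℝ)..0, ‖∑ i, c i * u1 i x‖ ^ 2 :=
    intervalIntegral.integral_nonneg (by norm_num) fun _ _ => by positivity
  have hp2 : 0 ≤ ∫ x in (0 : ℝ)..1, ‖∑ i, c i * u2 i x‖ ^ 2 :=
    intervalIntegral.integral_nonneg (by norm_num) fun _ _ => by positivity
  have hw1 : 0 < (a1 ^ 4)⁻¹ := by positivity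
  have hw2 : 0 < (a2 ^ 4)⁻¹ := by positivity
  have hm1 := mul_nonneg hw1.le hp1
  have hm2 := mul_nonneg hw2.le hp2
  have hsq := sq_nonneg ‖∑ i, c i * u2 i 1‖
  have hi1 : ∫ x in (-1 : ℝ)..0, ‖∑ i, c i * u1 i x‖ ^ 2 = 0 :=
    (mul_eq_zero.1 (by linarith)).resolve_left hw1.ne'
  have hi2 : ∫ x in (0 : ℝ)..1, ‖∑ i, c i * u2 i x‖ ^ 2 = 0 :=
    (mul_eq_zero.1 (by linarith)).resolve_left hw2.ne'
  have hz1 := eqOn_zero_of_integral_norm_sq_eq_zero (by norm_num)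
    (continuousOn_finsetSum _ fun i _ => continuousOn_const.mul (h1 i).1.continuousOn) hi1
  have hz2 := eqOn_zero_of_integral_norm_sq_eq_zero (by norm_num)
    (continuousOn_finsetSum _ fun i _ => continuousOn_const.mul (h2 i).1.continuousOn) hi2
  obtain ⟨i, hi⟩ := Function.ne_iff.1 hc0
  exact hne i
    ⟨fun x hx => (mul_eq_zero.1 (mul_eq_zero_of_sum_mul_eq_zero ha1 (by norm_num) hlam h1 c hz1
      i x hx)).resolve_left hi,
    fun x hx => (mul_eq_zero.1 (mul_eq_zero_of_sum_mul_eq_zero ha2 (by norm_num) hlam h2 c hz2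
      i x hx)).resolve_left hi⟩

theorem IsEigenvalue.exists_solvesProblem {a1 a2 β1 β2 δ1 δ2 : ℝ} {q : ℝ → ℝ} {lam : ℂ}
    (h : IsEigenvalue a1 a2 β1 β2 δ1 δ2 q lam) :
    ∃ u1 u2 : ℝ → ℂ, SolvesProblem a1 a2 β1 β2 δ1 δ2 q lam u1 u2 ∧
      ¬ (EqOn u1 0 (Icc (-1 : ℝ) 0) ∧ EqOn u2 0 (Icc (0 : ℝ) 1)) := by
  obtain ⟨u1, u2, h1, h2, hne, hrest⟩ := h
  exact ⟨u1, u2, ⟨h1, h2, hrest⟩, hne⟩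

/-- A set of eigenvalues containing no pair `λ = conj μ` is finite. -/
theorem finite_of_isEigenvalue {a1 a2 β1 β2 δ1 δ2 : ℝ} {q : ℝ → ℝ} (ha1 : 0 < a1)
    (ha2 : 0 < a2) (hβ : |β1| + |β2| ≠ 0) {E : Set ℂ}
    (hE : ∀ lam ∈ E, IsEigenvalue a1 a2 β1 β2 δ1 δ2 q lam)
    (hconj : ∀ lam ∈ E, ∀ mu ∈ E, lam ≠ star mu) : E.Finite := by
  by_contra hinf
  let e := Set.Infinite.natEmbedding E hinf
  let lam : Fin 4 → ℂ := fun i => e i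
  have hmem : ∀ i, lam i ∈ E := fun i => (e i).2
  have hlam : Function.Injective lam := fun i j hij =>
    Fin.ext (e.injective (Subtype.ext hij))
  choose u1 u2 hu hne using fun i => (hE _ (hmem i)).exists_solvesProblem
  exact not_forall_indefiniteForm_eq_zero (δ1 := δ1) (δ2 := δ2) ha1 ha2 hlam
    (fun i => (hu i).1) (fun i => (hu i).2.1) hne fun i j =>
    (hu i).indefiniteForm_eq_zero ha1 ha2 hβ (hu j) (hconj _ (hmem i) _ (hmem j))

/-- Corollary 4.6: the non-real eigenvalues of the problem (P) form a bounded
subset of `ℂ`. -/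
theorem nonreal_eigenvalues_bounded
    (a1 a2 β1 β2 δ1 δ2 : ℝ) (ha1 : 0 < a1) (ha2 : 0 < a2)
    (hβ : |β1| + |β2| ≠ 0) (hδ : |δ1| + |δ2| ≠ 0) (q : ℝ → ℝ)
    (hq1 : ContinuousOn q (Icc (-1 : ℝ) 0)) (hq2 : ContinuousOn q (Icc (0 : ℝ) 1)) :
    ∃ R > (0 : ℝ), ∀ lam : ℂ, IsEigenvalue a1 a2 β1 β2 δ1 δ2 q lam → lam.im ≠ 0 →
      ‖lam‖ ≤ R := by
  have hpos : {lam | IsEigenvalue a1 a2 β1 β2 δ1 δ2 q lam ∧ 0 < lam.im}.Finite := by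
    refine finite_of_isEigenvalue ha1 ha2 hβ (fun _ h => h.1) ?_
    rintro lam ⟨-, hl⟩ mu ⟨-, hm⟩ heq
    have := congrArg Complex.im heq
    simp only [Complex.star_def, Complex.conj_im] at this
    linarith
  have hneg : {lam | IsEigenvalue a1 a2 β1 β2 δ1 δ2 q lam ∧ lam.im < 0}.Finite := by
    refine finite_of_isEigenvalue ha1 ha2 hβ (fun _ h => h.1) ?_
    rintro lam ⟨-, hl⟩ mu ⟨-, hm⟩ heq
    have := congrArg Complex.im heq
    simp only [Complex.star_def, Complex.conj_im] at this
    linarith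
  obtain ⟨R, hR, hbound⟩ := (hpos.union hneg).isBounded.exists_pos_norm_le
  refine ⟨R, hR, fun lam hlam him => hbound lam ?_⟩
  rcases him.lt_or_gt with h | h
  · exact Or.inr ⟨hlam, h⟩
  · exact Or.inl ⟨hlam, h⟩
end

section
/- The set of eigenvalues of the boundary value problem (P) has no accumulation point in ℂ; equivalently, every bounded subset of ℂ contains only finitely many eigenvalues of (P). -/
open Set

open scoped ComplexConjugate

/-! ### Linear algebra of Hermitian pencils -/

/-- Distinct eigenvalues of a Hermitian pencil `(A, B)`, none conjugate to another, whose eigenvectors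
have `B`-norms of one sign: on their span `A` is controlled by `B`. -/
lemma norm_sesq_self_le_of_eigenvectors {E ι : Type*} [AddCommGroup E] [Module ℂ E] [Fintype ι]
    (A B : E →ₗ⋆[ℂ] E →ₗ[ℂ] ℂ) (hA : ∀ v w, conj (A v w) = A w v)
    (hB : ∀ v w, conj (B v w) = B w v) (u : ι → E) (lam : ι → ℂ)
    (heig : ∀ i v, A v (u i) = lam i * B v (u i))
    (hne : ∀ i j, i ≠ j → lam i ≠ conj (lam j)) {R : ℝ} (hR : ∀ i, ‖lam i‖ ≤ R)
    {σ : ℝ} (hσ : |σ| = 1) (hs : ∀ i, 0 ≤ σ * (B (u i) (u i)).re) (c : ι → ℂ) :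
    ‖A (∑ i, c i • u i) (∑ i, c i • u i)‖ ≤ R * ‖B (∑ i, c i • u i) (∑ i, c i • u i)‖ := by
  classical
  have hoff : ∀ i j, i ≠ j → B (u i) (u j) = 0 := by
    intro i j hij
    have h1 := heig j (u i)
    have h2 : A (u i) (u j) = conj (lam i) * B (u i) (u j) := by
      rw [← hA, heig i (u j), map_mul, hB]
    have h3 : (lam j - conj (lam i)) * B (u i) (u j) = 0 := by
      rw [sub_mul, ← h1, ← h2, sub_self]
    exact (mul_eq_zero.mp h3).resolve_left (sub_ne_zero.mpr (hne j i hij.symm))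
  have hoffA : ∀ i j, i ≠ j → A (u i) (u j) = 0 := fun i j hij => by
    rw [heig, hoff i j hij, mul_zero]
  have hdiag : ∀ i, B (u i) (u i) = ((B (u i) (u i)).re : ℂ) := fun i =>
    (Complex.conj_eq_iff_re.mp (hB (u i) (u i))).symm
  have hexp : ∀ F : E →ₗ⋆[ℂ] E →ₗ[ℂ] ℂ, (∀ i j, i ≠ j → F (u i) (u j) = 0) →
      F (∑ i, c i • u i) (∑ i, c i • u i) = ∑ i, ((‖c i‖ ^ 2 : ℝ) : ℂ) * F (u i) (u i) := by
    intro F hF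
    simp only [map_sum, LinearMap.sum_apply, map_smulₛₗ, LinearMap.smul_apply]
    refine Finset.sum_congr rfl fun i _ => ?_
    rw [Finset.sum_eq_single i (fun j _ hj => by simp [hF j i hj]) (by simp)]
    simp only [smul_eq_mul, RingHom.id_apply]
    rw [← mul_assoc, Complex.mul_conj, Complex.normSq_eq_norm_sq]
  have hBeq : B (∑ i, c i • u i) (∑ i, c i • u i)
      = ((σ * ∑ i, ‖c i‖ ^ 2 * (σ * (B (u i) (u i)).re) : ℝ) : ℂ) := by
    have hσ2 : σ * σ = 1 := by rw [← abs_mul_abs_self, hσ, one_mul]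
    rw [hexp B hoff, Finset.mul_sum, Complex.ofReal_sum]
    refine Finset.sum_congr rfl fun i _ => ?_
    rw [hdiag i, Complex.ofReal_re, ← Complex.ofReal_mul]
    congr 1
    linear_combination (-(‖c i‖ ^ 2 * (B (u i) (u i)).re)) * hσ2
  have hpos : ∀ i, 0 ≤ ‖c i‖ ^ 2 * (σ * (B (u i) (u i)).re) := fun i =>
    mul_nonneg (sq_nonneg _) (hs i)
  rw [hBeq, Complex.norm_real, Real.norm_eq_abs, abs_mul, hσ, one_mul,
    abs_of_nonneg (Finset.sum_nonneg fun i _ => hpos i), hexp A hoffA, Finset.mul_sum]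
  refine (norm_sum_le _ _).trans (Finset.sum_le_sum fun i _ => ?_)
  have hnB : ‖B (u i) (u i)‖ = σ * (B (u i) (u i)).re := by
    rw [hdiag i, Complex.norm_real, Complex.ofReal_re, ← abs_of_nonneg (hs i), abs_mul, hσ, one_mul,
      Real.norm_eq_abs]
  rw [heig i (u i), norm_mul, norm_mul, hnB, Complex.norm_real, Real.norm_of_nonneg (sq_nonneg _)]
  have := mul_le_mul_of_nonneg_right (hR i) (hpos i)
  linarith

/-- If more vectors are given than there are linear functionals, some nontrivial combination of the
vectors is annihilated by all of the functionals. -/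
lemma exists_combination_mem_ker {E ι κ : Type*} [AddCommGroup E] [Module ℂ E] [Fintype ι]
    [Fintype κ] (F : E →ₗ[ℂ] κ → ℂ) (u : ι → E) (h : Fintype.card κ < Fintype.card ι) :
    ∃ c : ι → ℂ, c ≠ 0 ∧ F (∑ i, c i • u i) = 0 := by
  have hk : (F ∘ₗ Fintype.linearCombination ℂ u).ker ≠ ⊥ :=
    LinearMap.ker_ne_bot_of_finrank_lt (by simpa using h)
  obtain ⟨c, hc, hc0⟩ := Submodule.exists_mem_ne_zero_of_ne_bot hk
  exact ⟨c, hc0, by simpa [Fintype.linearCombination_apply] using hc⟩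

/-- A sequence of vanishing power sums with distinct nodes has vanishing coefficients. -/
lemma eq_zero_of_forall_sum_mul_pow_eq_zero {ι : Type*} [Fintype ι] {lam : ι → ℂ}
    (hlam : Function.Injective lam) {v : ι → ℂ} (h : ∀ m : ℕ, ∑ i, v i * lam i ^ m = 0) : v = 0 := by
  have e := Fintype.equivFin ι
  have h0 : v ∘ e.symm = 0 :=
    Matrix.eq_zero_of_forall_pow_sum_mul_pow_eq_zero (hlam.comp e.symm.injective)
      fun m => (Equiv.sum_comp e.symm fun i => v i * lam i ^ (m : ℕ)).trans (h m)
  funext i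
  simpa using congrFun h0 (e i)

/-! ### Poincaré inequalities -/

/-- The Cauchy–Schwarz inequality against the constant function one. -/
lemma sq_integral_le_mul_integral_sq {f : ℝ → ℝ} {a b : ℝ} (hab : a < b)
    (hf : ContinuousOn f (Icc a b)) :
    (∫ x in a..b, f x) ^ 2 ≤ (b - a) * ∫ x in a..b, f x ^ 2 := by
  have hL : 0 < b - a := sub_pos.mpr hab
  have hi : IntervalIntegrable f MeasureTheory.volume a b := hf.intervalIntegrable_of_Icc hab.le
  have hi2 : IntervalIntegrable (fun x => f x ^ 2) MeasureTheory.volume a b :=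
    (hf.pow 2).intervalIntegrable_of_Icc hab.le
  set I := ∫ x in a..b, f x
  have h : 0 ≤ ∫ x in a..b, (f x ^ 2 - 2 * (I / (b - a)) * f x + (I / (b - a)) ^ 2) :=
    intervalIntegral.integral_nonneg hab.le fun x _ => by
      nlinarith [sq_nonneg (f x - I / (b - a))]
  rw [intervalIntegral.integral_add (hi2.sub (hi.const_mul _)) intervalIntegrable_const,
    intervalIntegral.integral_sub hi2 (hi.const_mul _), intervalIntegral.integral_const_mul,
    intervalIntegral.integral_const, smul_eq_mul] at h
  have h2 : 2 * (I / (b - a)) * I = 2 * (I ^ 2 / (b - a)) := by ring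
  have h3 : (b - a) * (I / (b - a)) ^ 2 = I ^ 2 / (b - a) := by field_simp
  rw [h2, h3] at h
  have h4 : I ^ 2 / (b - a) ≤ ∫ x in a..b, f x ^ 2 := by linarith
  rwa [div_le_iff₀' hL] at h4

lemma integral_norm_sq_le_of_eq_zero {f g : ℝ → ℂ} {a b : ℝ} (hab : a < b)
    (hf : ∀ x ∈ Icc a b, HasDerivWithinAt f (g x) (Icc a b) x) (hg : ContinuousOn g (Icc a b))
    (h0 : f a = 0) :
    ∫ x in a..b, ‖f x‖ ^ 2 ≤ (b - a) ^ 2 * ∫ x in a..b, ‖g x‖ ^ 2 := by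
  have hfc : ContinuousOn f (Icc a b) := fun x hx => (hf x hx).continuousWithinAt
  have hng : IntervalIntegrable (fun x => ‖g x‖) MeasureTheory.volume a b :=
    hg.norm.intervalIntegrable_of_Icc hab.le
  have hpt : ∀ x ∈ Icc a b, ‖f x‖ ≤ ∫ y in a..b, ‖g y‖ := by
    intro x hx
    have hsub : Icc a x ⊆ Icc a b := Icc_subset_Icc_right hx.2
    have hftc : ∫ y in a..x, g y = f x - f a :=
      intervalIntegral.integral_eq_sub_of_hasDerivAt_of_le hx.1 (hfc.mono hsub)
        (fun y hy => (hf y (hsub (Ioo_subset_Icc_self hy))).hasDerivAt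
          (Icc_mem_nhds hy.1 (hy.2.trans_le hx.2)))
        ((hg.mono hsub).intervalIntegrable_of_Icc hx.1)
    rw [h0, sub_zero] at hftc
    rw [← hftc]
    exact (intervalIntegral.norm_integral_le_integral_norm hx.1).trans
      (intervalIntegral.integral_mono_interval le_rfl hx.1 hx.2
        (Filter.Eventually.of_forall fun y => norm_nonneg _) hng)
  have hcs := sq_integral_le_mul_integral_sq hab hg.norm
  calc ∫ x in a..b, ‖f x‖ ^ 2 ≤ ∫ _x in a..b, (∫ y in a..b, ‖g y‖) ^ 2 :=
        intervalIntegral.integral_mono_on hab.le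
          ((hfc.norm.pow 2).intervalIntegrable_of_Icc hab.le) intervalIntegrable_const
          fun x hx => pow_le_pow_left₀ (norm_nonneg _) (hpt x hx) 2
    _ = (b - a) * (∫ y in a..b, ‖g y‖) ^ 2 := by simp
    _ ≤ (b - a) * ((b - a) * ∫ x in a..b, ‖g x‖ ^ 2) :=
        mul_le_mul_of_nonneg_left hcs (sub_pos.mpr hab).le
    _ = _ := by ring

/-- The Poincaré inequality for a function vanishing, along with its derivative, at the points of a
uniform grid. -/
lemma integral_norm_sq_le_of_grid {f f' f'' : ℝ → ℂ} {a b : ℝ} (hab : a < b) {n : ℕ} (hn : 0 < n)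
    (hf : ∀ x ∈ Icc a b, HasDerivWithinAt f (f' x) (Icc a b) x)
    (hf' : ∀ x ∈ Icc a b, HasDerivWithinAt f' (f'' x) (Icc a b) x)
    (hf'' : ContinuousOn f'' (Icc a b))
    (h0 : ∀ i < n, f (a + i * ((b - a) / n)) = 0) (h1 : ∀ i < n, f' (a + i * ((b - a) / n)) = 0) :
    ∫ x in a..b, ‖f x‖ ^ 2 ≤ ((b - a) / n) ^ 4 * ∫ x in a..b, ‖f'' x‖ ^ 2 := by
  have hn' : (0 : ℝ) < n := Nat.cast_pos.mpr hn
  have hh : 0 < (b - a) / n := div_pos (sub_pos.mpr hab) hn'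
  set h := (b - a) / n with hdef
  let p : ℕ → ℝ := fun i => a + i * h
  have hp0 : p 0 = a := by simp [p]
  have hpn : p n = b := by simp only [p, hdef]; field_simp; ring
  have hlt : ∀ i, p i < p (i + 1) := fun i => by simp only [p]; push_cast; nlinarith
  have hlen : ∀ i, p (i + 1) - p i = h := fun i => by simp only [p]; push_cast; ring
  have hmono : Monotone p := monotone_nat_of_le_succ fun i => (hlt i).le
  have hsub : ∀ i < n, Icc (p i) (p (i + 1)) ⊆ Icc a b := fun i hi =>
    Icc_subset_Icc (hp0 ▸ hmono (Nat.zero_le i)) (hpn ▸ hmono hi)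
  have hfc : ContinuousOn f (Icc a b) := fun x hx => (hf x hx).continuousWithinAt
  have hfc' : ContinuousOn f' (Icc a b) := fun x hx => (hf' x hx).continuousWithinAt
  have key : ∀ i < n, ∫ x in p i..p (i + 1), ‖f x‖ ^ 2
      ≤ h ^ 4 * ∫ x in p i..p (i + 1), ‖f'' x‖ ^ 2 := by
    intro i hi
    have e1 := integral_norm_sq_le_of_eq_zero (hlt i)
      (fun x hx => (hf x (hsub i hi hx)).mono (hsub i hi)) (hfc'.mono (hsub i hi)) (h0 i hi)
    have e2 := integral_norm_sq_le_of_eq_zero (hlt i)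
      (fun x hx => (hf' x (hsub i hi hx)).mono (hsub i hi)) (hf''.mono (hsub i hi)) (h1 i hi)
    rw [hlen] at e1 e2
    have := mul_le_mul_of_nonneg_left e2 (sq_nonneg h)
    nlinarith
  have hint : ∀ g : ℝ → ℂ, ContinuousOn g (Icc a b) → ∀ k < n,
      IntervalIntegrable (fun x => ‖g x‖ ^ 2) MeasureTheory.volume (p k) (p (k + 1)) :=
    fun g hg k hk => ((hg.norm.pow 2).mono (hsub k hk)).intervalIntegrable_of_Icc (hlt k).le
  rw [← hp0, ← hpn, ← intervalIntegral.sum_integral_adjacent_intervals (hint f hfc),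
    ← intervalIntegral.sum_integral_adjacent_intervals (hint f'' hf''), Finset.mul_sum]
  exact Finset.sum_le_sum fun i hi => key i (Finset.mem_range.mp hi)

/-! ### Jets and sesquilinear forms -/

/-- Sequences `f` with `f 0` four times continuously differentiable on `[s, t]` and `f k` its `k`-th
derivative for `k ≤ 4`. -/
def jetSpace (s t : ℝ) : Submodule ℂ (ℕ → ℝ → ℂ) where
  carrier := {f | (∀ k ≤ 4, ContinuousOn (f k) (Icc s t)) ∧
    ∀ k < 4, ∀ x ∈ Icc s t, HasDerivWithinAt (f k) (f (k + 1) x) (Icc s t) x}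
  add_mem' hf hg := ⟨fun k hk => (hf.1 k hk).add (hg.1 k hk),
    fun k hk x hx => (hf.2 k hk x hx).add (hg.2 k hk x hx)⟩
  zero_mem' := ⟨fun _ _ => continuousOn_const, fun _ _ _ _ => hasDerivWithinAt_const _ _ _⟩
  smul_mem' c _ hf := ⟨fun k hk => (hf.1 k hk).const_smul c,
    fun k hk x hx => (hf.2 k hk x hx).const_smul c⟩

lemma iteratedDerivWithin_mem_jetSpace {s t : ℝ} (hst : s < t) {u : ℝ → ℂ}
    (hu : ContDiffOn ℝ 4 u (Icc s t)) :
    (fun k => iteratedDerivWithin k u (Icc s t)) ∈ jetSpace s t := by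
  have hU := uniqueDiffOn_Icc hst
  refine ⟨fun k hk => hu.continuousOn_iteratedDerivWithin (by exact_mod_cast hk) hU,
    fun k hk x hx => ?_⟩
  simp only [iteratedDerivWithin_succ]
  exact (hu.differentiableOn_iteratedDerivWithin (by exact_mod_cast hk) hU x hx).hasDerivWithinAt

lemma eqOn_zero_of_mem_jetSpace {s t : ℝ} (hst : s < t) {f : ℕ → ℝ → ℂ} (hf : f ∈ jetSpace s t)
    (h0 : EqOn (f 0) 0 (Icc s t)) : ∀ k ≤ 4, EqOn (f k) 0 (Icc s t) := by
  intro k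
  induction k with
  | zero => exact fun _ => h0
  | succ k ih =>
    intro hk x hx
    have h1 := hf.2 k (by omega) x hx
    have h2 : HasDerivWithinAt (f k) 0 (Icc s t) x :=
      (hasDerivWithinAt_const x (Icc s t) (0 : ℂ)).congr (ih (by omega)) (ih (by omega) hx)
    exact (uniqueDiffOn_Icc hst x hx).eq_deriv _ h1 h2

/-- The sesquilinear form `(v, w) ↦ ∫ p (L v)* (L w)`. -/
noncomputable def weightedForm {E : Type*} [AddCommGroup E] [Module ℂ E] (p : ℝ → ℝ) {s t : ℝ}
    (hst : s ≤ t) (hp : ContinuousOn p (Icc s t)) (L : E →ₗ[ℂ] ℝ → ℂ)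
    (hL : ∀ v, ContinuousOn (L v) (Icc s t)) : E →ₗ⋆[ℂ] E →ₗ[ℂ] ℂ :=
  have hi : ∀ v w, IntervalIntegrable (fun x => (p x : ℂ) * (conj (L v x) * L w x))
      MeasureTheory.volume s t := fun v w =>
    ((Complex.continuous_ofReal.comp_continuousOn hp).mul
      ((Complex.continuous_conj.comp_continuousOn (hL v)).mul (hL w))).intervalIntegrable_of_Icc hst
  LinearMap.mk₂'ₛₗ _ _ (fun v w => ∫ x in s..t, (p x : ℂ) * (conj (L v x) * L w x))
    (fun v₁ v₂ w => by
      rw [← intervalIntegral.integral_add (hi v₁ w) (hi v₂ w)]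
      congr 1; ext x; simp only [map_add, Pi.add_apply]; ring)
    (fun c v w => by
      rw [smul_eq_mul, ← intervalIntegral.integral_const_mul]
      congr 1; ext x; simp only [map_smul, Pi.smul_apply, smul_eq_mul, map_mul]; ring)
    (fun v w₁ w₂ => by
      rw [← intervalIntegral.integral_add (hi v w₁) (hi v w₂)]
      congr 1; ext x; simp only [map_add, Pi.add_apply]; ring)
    (fun c v w => by
      rw [smul_eq_mul, ← intervalIntegral.integral_const_mul]
      congr 1; ext x; simp only [map_smul, Pi.smul_apply, smul_eq_mul, RingHom.id_apply]; ring)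

section WeightedForm

variable {E : Type*} [AddCommGroup E] [Module ℂ E] {p : ℝ → ℝ} {s t : ℝ} (hst : s ≤ t)
  (hp : ContinuousOn p (Icc s t)) (L : E →ₗ[ℂ] ℝ → ℂ) (hL : ∀ v, ContinuousOn (L v) (Icc s t))

lemma weightedForm_apply (v w : E) :
    weightedForm p hst hp L hL v w = ∫ x in s..t, (p x : ℂ) * (conj (L v x) * L w x) := rfl

lemma conj_weightedForm (v w : E) :
    conj (weightedForm p hst hp L hL v w) = weightedForm p hst hp L hL w v := by
  rw [weightedForm_apply, weightedForm_apply, ← intervalIntegral.intervalIntegral_conj]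
  congr 1; ext x; simp only [map_mul, Complex.conj_ofReal, Complex.conj_conj]; ring

lemma norm_weightedForm_self_le {K : ℝ} (hK : ∀ x ∈ Icc s t, |p x| ≤ K) (v : E) :
    ‖weightedForm p hst hp L hL v v‖ ≤ K * ∫ x in s..t, ‖L v x‖ ^ 2 := by
  rw [weightedForm_apply, ← intervalIntegral.integral_const_mul]
  refine intervalIntegral.norm_integral_le_of_norm_le hst (Filter.Eventually.of_forall ?_)
    ((continuousOn_const.mul ((hL v).norm.pow 2)).intervalIntegrable_of_Icc hst)
  intro x hx
  rw [norm_mul, norm_mul, RCLike.norm_conj, Complex.norm_real, Real.norm_eq_abs, ← sq]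
  exact mul_le_mul_of_nonneg_right (hK x (Ioc_subset_Icc_self hx)) (sq_nonneg _)

lemma weightedForm_one_self (h1 : ContinuousOn (fun _ : ℝ => (1 : ℝ)) (Icc s t)) (v : E) :
    weightedForm (fun _ => 1) hst h1 L hL v v = ((∫ x in s..t, ‖L v x‖ ^ 2 : ℝ) : ℂ) := by
  rw [weightedForm_apply, ← intervalIntegral.integral_ofReal]
  congr 1; ext x
  rw [← Complex.normSq_eq_conj_mul_self, Complex.normSq_eq_norm_sq]
  simp

end WeightedForm

/-- The sesquilinear form `(v, w) ↦ (l v)* (l w)`. -/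
noncomputable def pointForm {E : Type*} [AddCommGroup E] [Module ℂ E] (l : E →ₗ[ℂ] ℂ) :
    E →ₗ⋆[ℂ] E →ₗ[ℂ] ℂ :=
  LinearMap.mk₂'ₛₗ _ _ (fun v w => conj (l v) * l w)
    (fun _ _ _ => by simp only [map_add]; ring)
    (fun _ _ _ => by simp only [map_smul, smul_eq_mul, map_mul]; ring)
    (fun _ _ _ => by simp only [map_add]; ring)
    (fun _ _ _ => by simp only [map_smul, smul_eq_mul, RingHom.id_apply]; ring)

lemma pointForm_apply {E : Type*} [AddCommGroup E] [Module ℂ E] (l : E →ₗ[ℂ] ℂ) (v w : E) :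
    pointForm l v w = conj (l v) * l w := rfl

lemma conj_pointForm {E : Type*} [AddCommGroup E] [Module ℂ E] (l : E →ₗ[ℂ] ℂ) (v w : E) :
    conj (pointForm l v w) = pointForm l w v := by
  simp only [pointForm_apply, map_mul, Complex.conj_conj, mul_comm]

/-- Two integrations by parts. -/
lemma integral_conj_mul_fourth_deriv {s t : ℝ} (hst : s ≤ t) {f g : ℕ → ℝ → ℂ}
    (hf : f ∈ jetSpace s t) (hg : g ∈ jetSpace s t) :
    ∫ x in s..t, conj (f 0 x) * g 4 x
      = (conj (f 0 t) * g 3 t - conj (f 1 t) * g 2 t)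
        - (conj (f 0 s) * g 3 s - conj (f 1 s) * g 2 s) + ∫ x in s..t, conj (f 2 x) * g 2 x := by
  have hcj : ∀ k ≤ 4, ContinuousOn (fun x => conj (f k x)) (Icc s t) := fun k hk =>
    Complex.continuous_conj.comp_continuousOn (hf.1 k hk)
  have hdj : ∀ k < 4, ∀ x ∈ Icc s t,
      HasDerivWithinAt (fun x => conj (f k x)) (conj (f (k + 1) x)) (Icc s t) x :=
    fun k hk x hx => (hf.2 k hk x hx).star
  have hi4 : IntervalIntegrable (fun x => conj (f 0 x) * g 4 x) MeasureTheory.volume s t :=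
    ((hcj 0 (by omega)).mul (hg.1 4 le_rfl)).intervalIntegrable_of_Icc hst
  have hi2 : IntervalIntegrable (fun x => conj (f 2 x) * g 2 x) MeasureTheory.volume s t :=
    ((hcj 2 (by omega)).mul (hg.1 2 (by omega))).intervalIntegrable_of_Icc hst
  have hftc := intervalIntegral.integral_eq_sub_of_hasDerivAt_of_le hst
    (f := fun x => conj (f 0 x) * g 3 x - conj (f 1 x) * g 2 x)
    (f' := fun x => conj (f 0 x) * g 4 x - conj (f 2 x) * g 2 x)
    (((hcj 0 (by omega)).mul (hg.1 3 (by omega))).sub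
      ((hcj 1 (by omega)).mul (hg.1 2 (by omega))))
    (fun x hx => by
      have hx' := Ioo_subset_Icc_self hx
      have h := ((hdj 0 (by omega) x hx').mul (hg.2 3 (by omega) x hx')).sub
        ((hdj 1 (by omega) x hx').mul (hg.2 2 (by omega) x hx'))
      refine (h.hasDerivAt (Icc_mem_nhds hx.1 hx.2)).congr_deriv ?_
      simp only [Nat.reduceAdd]
      ring)
    (hi4.sub hi2)
  rw [intervalIntegral.integral_sub hi4 hi2] at hftc
  rw [← hftc, sub_add_cancel]

lemma green_of_solution {s t a : ℝ} (hst : s ≤ t) (ha : a ≠ 0) {q : ℝ → ℝ}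
    (hq : ContinuousOn q (Icc s t)) {lam : ℂ} {f g : ℕ → ℝ → ℂ}
    (hf : f ∈ jetSpace s t) (hg : g ∈ jetSpace s t)
    (hode : ∀ x ∈ Icc s t, (a : ℂ) ^ 4 * g 4 x + (q x : ℂ) * g 0 x = lam * g 0 x) :
    (∫ x in s..t, ((1 : ℝ) : ℂ) * (conj (f 2 x) * g 2 x))
        + ∫ x in s..t, ((q x / a ^ 4 : ℝ) : ℂ) * (conj (f 0 x) * g 0 x)
      = lam * (∫ x in s..t, ((1 / a ^ 4 : ℝ) : ℂ) * (conj (f 0 x) * g 0 x))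
        - (conj (f 0 t) * g 3 t - conj (f 1 t) * g 2 t)
        + (conj (f 0 s) * g 3 s - conj (f 1 s) * g 2 s) := by
  have ha' : (a : ℂ) ≠ 0 := Complex.ofReal_ne_zero.mpr ha
  have hfg : ContinuousOn (fun x => conj (f 0 x) * g 0 x) (Icc s t) :=
    (Complex.continuous_conj.comp_continuousOn (hf.1 0 (by omega))).mul (hg.1 0 (by omega))
  have hiq : IntervalIntegrable (fun x => ((q x / a ^ 4 : ℝ) : ℂ) * (conj (f 0 x) * g 0 x))
      MeasureTheory.volume s t :=
    ((Complex.continuous_ofReal.comp_continuousOn (hq.div_const _)).mul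
      hfg).intervalIntegrable_of_Icc hst
  have hi1 : IntervalIntegrable (fun x => lam * (((1 / a ^ 4 : ℝ) : ℂ) * (conj (f 0 x) * g 0 x)))
      MeasureTheory.volume s t :=
    (continuousOn_const.mul (continuousOn_const.mul hfg)).intervalIntegrable_of_Icc hst
  have h4 : ∫ x in s..t, conj (f 0 x) * g 4 x
      = lam * (∫ x in s..t, ((1 / a ^ 4 : ℝ) : ℂ) * (conj (f 0 x) * g 0 x))
        - ∫ x in s..t, ((q x / a ^ 4 : ℝ) : ℂ) * (conj (f 0 x) * g 0 x) := by
    rw [← intervalIntegral.integral_const_mul, ← intervalIntegral.integral_sub hi1 hiq]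
    refine intervalIntegral.integral_congr fun x hx => ?_
    rw [uIcc_of_le hst] at hx
    have := hode x hx
    push_cast
    field_simp
    linear_combination (conj (f 0 x)) * this
  rw [integral_conj_mul_fourth_deriv hst hf hg] at h4
  simp only [Complex.ofReal_one, one_mul]
  linear_combination h4

/-! ### The Hermitian pencil of the boundary value problem -/

/-- Pairs of jets on `[-1, 0]` and `[0, 1]` satisfying the boundary and transmission conditions that do
not involve the eigenvalue parameter. -/
def trialSpace (β1 β2 : ℝ) : Submodule ℂ ((ℕ → ℝ → ℂ) × (ℕ → ℝ → ℂ)) where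
  carrier := {f | f.1 ∈ jetSpace (-1) 0 ∧ f.2 ∈ jetSpace 0 1 ∧ f.1 0 (-1) = 0 ∧
    (β1 : ℂ) * f.1 1 (-1) + (β2 : ℂ) * f.1 2 (-1) = 0 ∧ f.2 0 0 = f.1 0 0 ∧ f.2 1 0 = f.1 1 0}
  add_mem' := by
    rintro f g ⟨f1, f2, f3, f4, f5, f6⟩ ⟨g1, g2, g3, g4, g5, g6⟩
    refine ⟨add_mem f1 g1, add_mem f2 g2, ?_, ?_, ?_, ?_⟩ <;>
      simp only [Prod.fst_add, Prod.snd_add, Pi.add_apply]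
    · rw [f3, g3, add_zero]
    · linear_combination f4 + g4
    · rw [f5, g5]
    · rw [f6, g6]
  zero_mem' := ⟨zero_mem _, zero_mem _, by simp, by simp, by simp, by simp⟩
  smul_mem' := by
    rintro c f ⟨f1, f2, f3, f4, f5, f6⟩
    refine ⟨Submodule.smul_mem _ c f1, Submodule.smul_mem _ c f2, ?_, ?_, ?_, ?_⟩ <;>
      simp only [Prod.smul_fst, Prod.smul_snd, Pi.smul_apply, smul_eq_mul]
    · rw [f3, mul_zero]
    · linear_combination c * f4
    · rw [f5]
    · rw [f6]

namespace trialSpace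

variable {β1 β2 : ℝ}

/-- The `k`-th derivative on `[-1, 0]`. -/
def left (k : ℕ) : trialSpace β1 β2 →ₗ[ℂ] ℝ → ℂ :=
  LinearMap.proj k ∘ₗ LinearMap.fst ℂ _ _ ∘ₗ (trialSpace β1 β2).subtype

/-- The `k`-th derivative on `[0, 1]`. -/
def right (k : ℕ) : trialSpace β1 β2 →ₗ[ℂ] ℝ → ℂ :=
  LinearMap.proj k ∘ₗ LinearMap.snd ℂ _ _ ∘ₗ (trialSpace β1 β2).subtype

lemma left_apply (k : ℕ) (v : trialSpace β1 β2) : left k v = v.1.1 k := rfl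

lemma right_apply (k : ℕ) (v : trialSpace β1 β2) : right k v = v.1.2 k := rfl

lemma continuousOn_left {k : ℕ} (hk : k ≤ 4) (v : trialSpace β1 β2) :
    ContinuousOn (left k v) (Icc (-1) 0) := v.2.1.1 k hk

lemma continuousOn_right {k : ℕ} (hk : k ≤ 4) (v : trialSpace β1 β2) :
    ContinuousOn (right k v) (Icc 0 1) := v.2.2.1.1 k hk

variable (a1 a2 δ1 δ2 : ℝ) {q : ℝ → ℝ}
  (hq1 : ContinuousOn q (Icc (-1 : ℝ) 0)) (hq2 : ContinuousOn q (Icc (0 : ℝ) 1))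

/-- The form `∫ v''* w'' + ∫ (q / a ^ 4) v* w - (β1 / β2) v'(-1)* w'(-1)`. -/
noncomputable def energyForm : trialSpace β1 β2 →ₗ⋆[ℂ] trialSpace β1 β2 →ₗ[ℂ] ℂ :=
  weightedForm (fun _ => 1) (by norm_num) continuousOn_const (left 2)
      (continuousOn_left (by norm_num))
    + weightedForm (fun x => q x / a1 ^ 4) (by norm_num) (hq1.div_const _) (left 0)
      (continuousOn_left (by norm_num))
    + weightedForm (fun _ => 1) (by norm_num) continuousOn_const (right 2)
      (continuousOn_right (by norm_num))
    + weightedForm (fun x => q x / a2 ^ 4) (by norm_num) (hq2.div_const _) (right 0)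
      (continuousOn_right (by norm_num))
    + ((-β1 / β2 : ℝ) : ℂ) • pointForm (LinearMap.proj (-1) ∘ₗ left 1)

/-- The form `∫ v* w / a ^ 4 + v(1)* w(1) - v'(1)* w'(1) - δ2 v(0)* w(0) + δ1 v'(0)* w'(0)`. -/
noncomputable def massForm : trialSpace β1 β2 →ₗ⋆[ℂ] trialSpace β1 β2 →ₗ[ℂ] ℂ :=
  weightedForm (fun _ => 1 / a1 ^ 4) (by norm_num) continuousOn_const (left 0)
      (continuousOn_left (by norm_num))
    + weightedForm (fun _ => 1 / a2 ^ 4) (by norm_num) continuousOn_const (right 0)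
      (continuousOn_right (by norm_num))
    + pointForm (LinearMap.proj 1 ∘ₗ right 0) - pointForm (LinearMap.proj 1 ∘ₗ right 1)
    + (-(δ2 : ℂ)) • pointForm (LinearMap.proj 0 ∘ₗ left 0)
    + (δ1 : ℂ) • pointForm (LinearMap.proj 0 ∘ₗ left 1)

lemma conj_energyForm (v w : trialSpace β1 β2) :
    conj (energyForm a1 a2 hq1 hq2 v w) = energyForm a1 a2 hq1 hq2 w v := by
  simp only [energyForm, LinearMap.add_apply, LinearMap.smul_apply, map_add, smul_eq_mul, map_mul,
    conj_weightedForm, conj_pointForm, Complex.conj_ofReal]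

lemma conj_massForm (v w : trialSpace β1 β2) :
    conj (massForm a1 a2 δ1 δ2 v w) = massForm a1 a2 δ1 δ2 w v := by
  simp only [massForm, LinearMap.add_apply, LinearMap.sub_apply, LinearMap.smul_apply, map_add,
    map_sub, map_neg, smul_eq_mul, map_mul, conj_weightedForm, conj_pointForm, Complex.conj_ofReal]

variable (q) in
/-- `w` satisfies the differential equations and the conditions of the problem that involve the
eigenvalue parameter. -/
structure IsSolution (lam : ℂ) (w : trialSpace β1 β2) : Prop where
  ode_left : ∀ x ∈ Icc (-1 : ℝ) 0,
    (a1 : ℂ) ^ 4 * w.1.1 4 x + (q x : ℂ) * w.1.1 0 x = lam * w.1.1 0 x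
  ode_right : ∀ x ∈ Icc (0 : ℝ) 1,
    (a2 : ℂ) ^ 4 * w.1.2 4 x + (q x : ℂ) * w.1.2 0 x = lam * w.1.2 0 x
  jump_two : w.1.2 2 0 - w.1.1 2 0 + lam * δ1 * w.1.1 1 0 = 0
  jump_three : w.1.2 3 0 - w.1.1 3 0 + lam * δ2 * w.1.1 0 0 = 0
  end_three : lam * w.1.2 0 1 + w.1.2 3 1 = 0
  end_two : lam * w.1.2 1 1 + w.1.2 2 1 = 0

lemma robin_term (hβ : |β1| + |β2| ≠ 0) (v w : trialSpace β1 β2) :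
    conj (v.1.1 1 (-1)) * w.1.1 2 (-1)
      = ((-β1 / β2 : ℝ) : ℂ) * (conj (v.1.1 1 (-1)) * w.1.1 1 (-1)) := by
  have hv := v.2.2.2.2.1
  have hw := w.2.2.2.2.1
  rcases eq_or_ne β2 0 with h | h
  · have h1 : (β1 : ℂ) ≠ 0 := by
      intro h1
      simp [h, Complex.ofReal_eq_zero.mp h1] at hβ
    have hv1 : v.1.1 1 (-1) = 0 := by simpa [h, h1] using hv
    simp [hv1]
  · have h' : (β2 : ℂ) ≠ 0 := Complex.ofReal_ne_zero.mpr h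
    push_cast
    field_simp
    linear_combination conj (v.1.1 1 (-1)) * hw

variable {a1 a2 δ1 δ2} in
lemma IsSolution.energyForm_eq {lam : ℂ} {w : trialSpace β1 β2} (ha1 : a1 ≠ 0) (ha2 : a2 ≠ 0)
    (hβ : |β1| + |β2| ≠ 0) (hw : IsSolution a1 a2 δ1 δ2 q lam w) (v : trialSpace β1 β2) :
    energyForm a1 a2 hq1 hq2 v w = lam * massForm a1 a2 δ1 δ2 v w := by
  have h1 := green_of_solution (by norm_num) ha1 hq1 v.2.1 w.2.1 hw.ode_left
  have h2 := green_of_solution (by norm_num) ha2 hq2 v.2.2.1 w.2.2.1 hw.ode_right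
  have hr := robin_term hβ v w
  rw [v.2.2.2.1, map_zero, zero_mul, zero_sub, hr] at h1
  rw [v.2.2.2.2.2.1, v.2.2.2.2.2.2] at h2
  simp only [energyForm, massForm, LinearMap.add_apply, LinearMap.sub_apply, LinearMap.smul_apply,
    weightedForm_apply, pointForm_apply, smul_eq_mul, left_apply, right_apply,
    LinearMap.comp_apply, LinearMap.proj_apply]
  linear_combination h1 + h2 + conj (v.1.1 0 0) * hw.jump_three - conj (v.1.1 1 0) * hw.jump_two
    - conj (v.1.2 0 1) * hw.end_three + conj (v.1.2 1 1) * hw.end_two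

/-- The values and first derivatives at uniform grids on both intervals. -/
noncomputable def gridValues (n : ℕ) : trialSpace β1 β2 →ₗ[ℂ]
    (Bool × Fin 2 × Fin (n + 1) → ℂ) :=
  LinearMap.pi fun j =>
    if j.1 then LinearMap.proj (-1 + (j.2.2 : ℕ) * ((0 - -1 : ℝ) / n)) ∘ₗ left (j.2.1 : ℕ)
    else LinearMap.proj (0 + (j.2.2 : ℕ) * ((1 - 0 : ℝ) / n)) ∘ₗ right (j.2.1 : ℕ)

lemma left_eq_zero_of_gridValues {n : ℕ} {v : trialSpace β1 β2} (hv : gridValues n v = 0)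
    {k i : ℕ} (hk : k < 2) (hi : i < n + 1) : left k v (-1 + i * ((0 - -1 : ℝ) / n)) = 0 := by
  simpa [gridValues] using congrFun hv (true, ⟨k, hk⟩, ⟨i, hi⟩)

lemma right_eq_zero_of_gridValues {n : ℕ} {v : trialSpace β1 β2} (hv : gridValues n v = 0)
    {k i : ℕ} (hk : k < 2) (hi : i < n + 1) : right k v (0 + i * ((1 - 0 : ℝ) / n)) = 0 := by
  simpa [gridValues] using congrFun hv (false, ⟨k, hk⟩, ⟨i, hi⟩)

/-- On trial functions vanishing to second order on a fine enough grid, the energy form strictly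
dominates any multiple of the mass form. -/
lemma exists_grid_eqOn_zero (R : ℝ) (hR : 0 ≤ R) :
    ∃ n : ℕ, ∀ v : trialSpace β1 β2, gridValues n v = 0 →
      ‖energyForm a1 a2 hq1 hq2 v v‖ ≤ R * ‖massForm a1 a2 δ1 δ2 v v‖ →
      EqOn (left 0 v) 0 (Icc (-1) 0) ∧ EqOn (right 0 v) 0 (Icc 0 1) := by
  obtain ⟨K1, hK1⟩ := isCompact_Icc.exists_bound_of_continuousOn (hq1.div_const (a1 ^ 4))
  obtain ⟨K2, hK2⟩ := isCompact_Icc.exists_bound_of_continuousOn (hq2.div_const (a2 ^ 4))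
  set C : ℝ := R * max |1 / a1 ^ 4| |1 / a2 ^ 4| + max K1 K2 with hC
  obtain ⟨n, hn⟩ := exists_nat_gt (max C 1)
  have hn1 : (1 : ℝ) < n := (le_max_right _ _).trans_lt hn
  have hn0 : 0 < n := by exact_mod_cast one_pos.trans hn1
  have hnC : C < n := (le_max_left _ _).trans_lt hn
  refine ⟨n, fun v hv hle => ?_⟩
  have hn' : (n : ℝ) ≠ 0 := by positivity
  have e0 : left 0 v 0 = 0 := by
    have := left_eq_zero_of_gridValues hv (k := 0) (i := n) (by omega) (by omega)
    rwa [mul_div_cancel₀ _ hn', add_sub_cancel] at this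
  have e1 : left 1 v 0 = 0 := by
    have := left_eq_zero_of_gridValues hv (k := 1) (i := n) (by omega) (by omega)
    rwa [mul_div_cancel₀ _ hn', add_sub_cancel] at this
  have e2 : right 0 v 1 = 0 := by
    have := right_eq_zero_of_gridValues hv (k := 0) (i := n) (by omega) (by omega)
    rwa [mul_div_cancel₀ _ hn', add_sub_cancel] at this
  have e3 : right 1 v 1 = 0 := by
    have := right_eq_zero_of_gridValues hv (k := 1) (i := n) (by omega) (by omega)
    rwa [mul_div_cancel₀ _ hn', add_sub_cancel] at this
  have e4 : left 1 v (-1) = 0 := by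
    simpa using left_eq_zero_of_gridValues hv (k := 1) (i := 0) (by omega) (by omega)
  have p1 := integral_norm_sq_le_of_grid (by norm_num : (-1 : ℝ) < 0) hn0
    (v.2.1.2 0 (by omega)) (v.2.1.2 1 (by omega)) (v.2.1.1 2 (by omega))
    (fun i hi => left_eq_zero_of_gridValues hv (k := 0) (by omega) (by omega))
    (fun i hi => left_eq_zero_of_gridValues hv (k := 1) (by omega) (by omega))
  have p2 := integral_norm_sq_le_of_grid (by norm_num : (0 : ℝ) < 1) hn0
    (v.2.2.1.2 0 (by omega)) (v.2.2.1.2 1 (by omega)) (v.2.2.1.1 2 (by omega))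
    (fun i hi => right_eq_zero_of_gridValues hv (k := 0) (by omega) (by omega))
    (fun i hi => right_eq_zero_of_gridValues hv (k := 1) (by omega) (by omega))
  simp only [Nat.reduceAdd, ← left_apply, ← right_apply] at p1 p2
  rw [show (0 - -1 : ℝ) = 1 by norm_num] at p1
  rw [show (1 - 0 : ℝ) = 1 by norm_num] at p2
  set N1 := ∫ x in (-1 : ℝ)..0, ‖left 0 v x‖ ^ 2 with hN1
  set N2 := ∫ x in (0 : ℝ)..1, ‖right 0 v x‖ ^ 2 with hN2
  set S1 := ∫ x in (-1 : ℝ)..0, ‖left 2 v x‖ ^ 2 with hS1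
  set S2 := ∫ x in (0 : ℝ)..1, ‖right 2 v x‖ ^ 2 with hS2
  have N1nn : 0 ≤ N1 := intervalIntegral.integral_nonneg (by norm_num) fun _ _ => sq_nonneg _
  have N2nn : 0 ≤ N2 := intervalIntegral.integral_nonneg (by norm_num) fun _ _ => sq_nonneg _
  have S1nn : 0 ≤ S1 := intervalIntegral.integral_nonneg (by norm_num) fun _ _ => sq_nonneg _
  have S2nn : 0 ≤ S2 := intervalIntegral.integral_nonneg (by norm_num) fun _ _ => sq_nonneg _
  have hmass : ‖massForm a1 a2 δ1 δ2 v v‖ ≤ max |1 / a1 ^ 4| |1 / a2 ^ 4| * (N1 + N2) := by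
    simp only [massForm, LinearMap.add_apply, LinearMap.sub_apply, LinearMap.smul_apply,
      pointForm_apply, smul_eq_mul, LinearMap.comp_apply, LinearMap.proj_apply, e0, e1, e2, e3,
      mul_zero, add_zero, sub_zero]
    rw [mul_add]
    exact (norm_add_le _ _).trans (add_le_add
      (norm_weightedForm_self_le _ _ _ _ (fun _ _ => le_max_left _ _) v)
      (norm_weightedForm_self_le _ _ _ _ (fun _ _ => le_max_right _ _) v))
  have hen : S1 + S2 ≤ ‖energyForm a1 a2 hq1 hq2 v v‖ + max K1 K2 * (N1 + N2) := by
    have b1 := norm_weightedForm_self_le (by norm_num) (hq1.div_const (a1 ^ 4)) (left 0)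
      (continuousOn_left (by norm_num)) (fun x hx => (hK1 x hx).trans (le_max_left K1 K2)) v
    have b2 := norm_weightedForm_self_le (by norm_num) (hq2.div_const (a2 ^ 4)) (right 0)
      (continuousOn_right (by norm_num)) (fun x hx => (hK2 x hx).trans (le_max_right K1 K2)) v
    have hS : ((S1 + S2 : ℝ) : ℂ) = energyForm a1 a2 hq1 hq2 v v
        - (weightedForm (fun x => q x / a1 ^ 4) (by norm_num) (hq1.div_const _) (left 0)
          (continuousOn_left (by norm_num)) v v
        + weightedForm (fun x => q x / a2 ^ 4) (by norm_num) (hq2.div_const _) (right 0)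
          (continuousOn_right (by norm_num)) v v) := by
      simp only [energyForm, LinearMap.add_apply, LinearMap.smul_apply, pointForm_apply,
        smul_eq_mul, LinearMap.comp_apply, LinearMap.proj_apply, e4, mul_zero, add_zero,
        weightedForm_one_self]
      push_cast
      ring
    have hnn : S1 + S2 = ‖((S1 + S2 : ℝ) : ℂ)‖ := by
      rw [Complex.norm_real, Real.norm_of_nonneg (add_nonneg S1nn S2nn)]
    rw [hnn, hS]
    have t1 := norm_sub_le (energyForm a1 a2 hq1 hq2 v v)
      (weightedForm (fun x => q x / a1 ^ 4) (by norm_num) (hq1.div_const _) (left 0)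
          (continuousOn_left (by norm_num)) v v
        + weightedForm (fun x => q x / a2 ^ 4) (by norm_num) (hq2.div_const _) (right 0)
          (continuousOn_right (by norm_num)) v v)
    refine t1.trans (add_le_add le_rfl ((norm_add_le _ _).trans ?_))
    rw [mul_add]
    exact add_le_add b1 b2
  have hSC : S1 + S2 ≤ C * (N1 + N2) := by
    have := mul_le_mul_of_nonneg_left hmass hR
    rw [hC]
    linarith
  have hpow : (1 / (n : ℝ)) ^ 4 ≤ 1 / n :=
    pow_le_of_le_one (by positivity) ((div_le_one (by positivity)).mpr hn1.le) (by norm_num)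
  have hNS : (n : ℝ) * (N1 + N2) ≤ S1 + S2 := by
    have h := mul_le_mul_of_nonneg_right hpow (add_nonneg S1nn S2nn)
    have h' : N1 + N2 ≤ 1 / n * (S1 + S2) := by linarith
    have := mul_le_mul_of_nonneg_left h' (Nat.cast_nonneg (α := ℝ) n)
    rwa [← mul_assoc, mul_one_div_cancel hn', one_mul] at this
  have hN : N1 + N2 ≤ 0 := by
    by_contra! hpos
    have := mul_lt_mul_of_pos_right hnC hpos
    linarith
  have hzero : ∀ (s t : ℝ) (f : ℝ → ℂ), s < t → ContinuousOn f (Icc s t) →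
      ∫ x in s..t, ‖f x‖ ^ 2 ≤ 0 → EqOn f 0 (Icc s t) := by
    intro s t f hst hf hle x hx
    by_contra hne
    exact hle.not_gt (intervalIntegral.integral_pos hst (hf.norm.pow 2) (fun _ _ => sq_nonneg _)
      ⟨x, hx, pow_pos (norm_pos_iff.mpr hne) 2⟩)
  exact ⟨hzero _ _ _ (by norm_num) (continuousOn_left (by norm_num) v) (by linarith),
    hzero _ _ _ (by norm_num) (continuousOn_right (by norm_num) v) (by linarith)⟩

variable {a1 a2 δ1 δ2}

/-- Nonzero solutions for distinct eigenvalues are linearly independent. -/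
lemma eq_zero_of_sum_solutions_eqOn_zero {ι : Type*} [Fintype ι] {lam : ι → ℂ}
    (hlam : Function.Injective lam) {u : ι → trialSpace β1 β2}
    (hu : ∀ i, IsSolution a1 a2 δ1 δ2 q (lam i) (u i))
    (hu0 : ∀ i, ¬ (EqOn (left 0 (u i)) 0 (Icc (-1) 0) ∧ EqOn (right 0 (u i)) 0 (Icc 0 1)))
    {c : ι → ℂ} (h1 : EqOn (left 0 (∑ i, c i • u i)) 0 (Icc (-1) 0))
    (h2 : EqOn (right 0 (∑ i, c i • u i)) 0 (Icc 0 1)) : c = 0 := by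
  have step : ∀ d : ι → ℂ, EqOn (left 0 (∑ i, d i • u i)) 0 (Icc (-1) 0) →
      EqOn (right 0 (∑ i, d i • u i)) 0 (Icc 0 1) →
      EqOn (left 0 (∑ i, (d i * lam i) • u i)) 0 (Icc (-1) 0) ∧
      EqOn (right 0 (∑ i, (d i * lam i) • u i)) 0 (Icc 0 1) := by
    intro d hd1 hd2
    constructor
    · intro x hx
      have h4 : left 4 (∑ i, d i • u i) x = 0 :=
        eqOn_zero_of_mem_jetSpace (by norm_num) (∑ i, d i • u i).2.1 hd1 4 le_rfl hx
      have h0 := hd1 hx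
      simp only [map_sum, map_smul, Finset.sum_apply, Pi.smul_apply, smul_eq_mul,
        Pi.zero_apply] at h4 h0 ⊢
      calc ∑ i, d i * lam i * left 0 (u i) x
          = ∑ i, ((a1 : ℂ) ^ 4 * (d i * left 4 (u i) x)
              + (q x : ℂ) * (d i * left 0 (u i) x)) :=
            Finset.sum_congr rfl fun i _ => by
              have := (hu i).ode_left x hx
              simp only [left_apply]
              linear_combination -(d i) * this
        _ = 0 := by
          rw [Finset.sum_add_distrib, ← Finset.mul_sum, ← Finset.mul_sum, h4, h0, mul_zero,
            mul_zero, add_zero]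
    · intro x hx
      have h4 : right 4 (∑ i, d i • u i) x = 0 :=
        eqOn_zero_of_mem_jetSpace (by norm_num) (∑ i, d i • u i).2.2.1 hd2 4 le_rfl hx
      have h0 := hd2 hx
      simp only [map_sum, map_smul, Finset.sum_apply, Pi.smul_apply, smul_eq_mul,
        Pi.zero_apply] at h4 h0 ⊢
      calc ∑ i, d i * lam i * right 0 (u i) x
          = ∑ i, ((a2 : ℂ) ^ 4 * (d i * right 4 (u i) x)
              + (q x : ℂ) * (d i * right 0 (u i) x)) :=
            Finset.sum_congr rfl fun i _ => by
              have := (hu i).ode_right x hx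
              simp only [right_apply]
              linear_combination -(d i) * this
        _ = 0 := by
          rw [Finset.sum_add_distrib, ← Finset.mul_sum, ← Finset.mul_sum, h4, h0, mul_zero,
            mul_zero, add_zero]
  have hpow : ∀ m : ℕ, EqOn (left 0 (∑ i, (c i * lam i ^ m) • u i)) 0 (Icc (-1) 0) ∧
      EqOn (right 0 (∑ i, (c i * lam i ^ m) • u i)) 0 (Icc 0 1) := by
    intro m
    induction m with
    | zero => simpa using And.intro h1 h2
    | succ m ih => simpa only [pow_succ, mul_assoc] using step _ ih.1 ih.2
  have hvan : ∀ L : trialSpace β1 β2 →ₗ[ℂ] ℂ,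
      (∀ m : ℕ, L (∑ i, (c i * lam i ^ m) • u i) = 0) → ∀ i, c i = 0 ∨ L (u i) = 0 := by
    intro L hL i
    have := eq_zero_of_forall_sum_mul_pow_eq_zero hlam (v := fun i => c i * L (u i)) fun m => by
      rw [← hL m, map_sum]
      exact Finset.sum_congr rfl fun i _ => by rw [map_smul, smul_eq_mul]; ring
    exact mul_eq_zero.mp (congrFun this i)
  funext i
  by_contra hc
  refine hu0 i ⟨fun x hx => ?_, fun x hx => ?_⟩
  · exact (hvan (LinearMap.proj x ∘ₗ left 0) (fun m => (hpow m).1 hx) i).resolve_left hc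
  · exact (hvan (LinearMap.proj x ∘ₗ right 0) (fun m => (hpow m).2 hx) i).resolve_left hc

end trialSpace

lemma IsEigenvalue.exists_isSolution {a1 a2 β1 β2 δ1 δ2 : ℝ} {q : ℝ → ℝ} {lam : ℂ}
    (h : IsEigenvalue a1 a2 β1 β2 δ1 δ2 q lam) :
    ∃ w : trialSpace β1 β2, trialSpace.IsSolution a1 a2 δ1 δ2 q lam w ∧
      ¬ (EqOn (trialSpace.left 0 w) 0 (Icc (-1) 0) ∧
        EqOn (trialSpace.right 0 w) 0 (Icc 0 1)) := by
  obtain ⟨u1, u2, ⟨hc1, ho1⟩, ⟨hc2, ho2⟩, hne, b1, b2, t1, t2, t3, t4, r1, r2⟩ := h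
  refine ⟨⟨(fun k => iteratedDerivWithin k u1 (Icc (-1) 0),
    fun k => iteratedDerivWithin k u2 (Icc 0 1)),
    iteratedDerivWithin_mem_jetSpace (by norm_num) hc1,
    iteratedDerivWithin_mem_jetSpace (by norm_num) hc2, ?_, b2, ?_, t2⟩, ⟨?_, ?_, t3, ?_, ?_, r2⟩, ?_⟩
  all_goals simpa only [trialSpace.left_apply, trialSpace.right_apply, iteratedDerivWithin_zero]

/-- The set of eigenvalues of the problem (P) has no accumulation point in `ℂ`;
equivalently, every bounded subset of `ℂ` contains only finitely many eigenvalues. -/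
theorem eigenvalues_no_accumulation
    (a1 a2 β1 β2 δ1 δ2 : ℝ) (ha1 : 0 < a1) (ha2 : 0 < a2)
    (hβ : |β1| + |β2| ≠ 0) (hδ : |δ1| + |δ2| ≠ 0) (q : ℝ → ℝ)
    (hq1 : ContinuousOn q (Icc (-1 : ℝ) 0)) (hq2 : ContinuousOn q (Icc (0 : ℝ) 1)) :
    (∀ z : ℂ, ¬ AccPt z (Filter.principal {lam : ℂ | IsEigenvalue a1 a2 β1 β2 δ1 δ2 q lam})) ∧
    ∀ S : Set ℂ, Bornology.IsBounded S →
      {lam : ℂ | IsEigenvalue a1 a2 β1 β2 δ1 δ2 q lam ∧ lam ∈ S}.Finite := by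
  have hfin : ∀ S : Set ℂ, Bornology.IsBounded S →
      {lam : ℂ | IsEigenvalue a1 a2 β1 β2 δ1 δ2 q lam ∧ lam ∈ S}.Finite := by
    intro S hS
    obtain ⟨R, hRpos, hR⟩ := hS.exists_pos_norm_le
    choose! w hw hw0 using fun lam : ℂ =>
      IsEigenvalue.exists_isSolution (a1 := a1) (a2 := a2) (β1 := β1) (β2 := β2) (δ1 := δ1)
        (δ2 := δ2) (q := q) (lam := lam)
    obtain ⟨n, hn⟩ := trialSpace.exists_grid_eqOn_zero (β1 := β1) (β2 := β2) a1 a2 δ1 δ2 hq1 hq2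
      R hRpos.le
    let T : ℝ → ℝ → Set ℂ := fun τ σ =>
      {lam | (IsEigenvalue a1 a2 β1 β2 δ1 δ2 q lam ∧ lam ∈ S) ∧ 0 ≤ τ * lam.im ∧
        0 ≤ σ * (trialSpace.massForm a1 a2 δ1 δ2 (w lam) (w lam)).re}
    have hT : ∀ τ σ, |τ| = 1 → |σ| = 1 → (T τ σ).Finite := by
      intro τ σ hτ hσ
      by_contra hinf
      obtain ⟨t, htT, htc⟩ := Set.Infinite.exists_subset_card_eq hinf
        (Fintype.card (Bool × Fin 2 × Fin (n + 1)) + 1)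
      have ht : ∀ i : t, (i : ℂ) ∈ T τ σ := fun i => htT i.2
      obtain ⟨c, hc0, hc⟩ := exists_combination_mem_ker (trialSpace.gridValues n)
        (fun i : t => w i) (by rw [Fintype.card_coe, htc]; exact Nat.lt_succ_self _)
      have hle := norm_sesq_self_le_of_eigenvectors (trialSpace.energyForm a1 a2 hq1 hq2)
        (trialSpace.massForm a1 a2 δ1 δ2) (trialSpace.conj_energyForm a1 a2 hq1 hq2)
        (trialSpace.conj_massForm a1 a2 δ1 δ2) (fun i : t => w i) (fun i => (i : ℂ))
        (fun i => (hw i (ht i).1.1).energyForm_eq hq1 hq2 ha1.ne' ha2.ne' hβ)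
        (by
          intro i j hij heq
          apply hij
          have him : (i : ℂ).im = -(j : ℂ).im := by rw [heq, Complex.conj_im]
          have hre : (i : ℂ).re = (j : ℂ).re := by rw [heq, Complex.conj_re]
          have hi := (ht i).2.1
          have hj := (ht j).2.1
          have hτ0 : τ ≠ 0 := by rintro rfl; simp at hτ
          have hz : τ * (j : ℂ).im = 0 := by rw [him] at hi; linarith
          have hj0 : (j : ℂ).im = 0 := (mul_eq_zero.mp hz).resolve_left hτ0
          exact Subtype.ext (Complex.ext hre (by rw [him, hj0, neg_zero])))
        (fun i => hR i (ht i).1.2) hσ (fun i => (ht i).2.2) c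
      obtain ⟨hl, hr⟩ := hn _ hc hle
      exact hc0 (trialSpace.eq_zero_of_sum_solutions_eqOn_zero Subtype.val_injective
        (fun i : t => hw i (ht i).1.1) (fun i => hw0 i (ht i).1.1) hl hr)
    refine ((((hT 1 1 ?_ ?_).union (hT 1 (-1) ?_ ?_)).union (hT (-1) 1 ?_ ?_)).union
      (hT (-1) (-1) ?_ ?_)).subset ?_
    any_goals simp
    rintro lam hlam
    have sgn : ∀ x : ℝ, 0 ≤ 1 * x ∨ 0 ≤ -1 * x := fun x => by
      rcases le_total 0 x with h | h
      · left; linarith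
      · right; linarith
    rcases sgn lam.im with h | h <;>
      rcases sgn (trialSpace.massForm a1 a2 δ1 δ2 (w lam) (w lam)).re with h' | h'
    · exact Or.inl (Or.inl (Or.inl ⟨hlam, h, h'⟩))
    · exact Or.inl (Or.inl (Or.inr ⟨hlam, h, h'⟩))
    · exact Or.inl (Or.inr ⟨hlam, h, h'⟩)
    · exact Or.inr ⟨hlam, h, h'⟩
  refine ⟨fun z hz => ?_, hfin⟩
  have hz' := hz.nhds_inter (Metric.ball_mem_nhds z one_pos)
  exact Set.Infinite.of_accPt hz'
    ((hfin (Metric.ball z 1) Metric.isBounded_ball).subset fun lam h => ⟨h.2, h.1⟩)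
end
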